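/- arXiv:1608.04000 — 7 statements merged into one kernel-verified Lean document; each statement's English description precedes it below -/
import Mathlib

section
/- Let m, n, k be positive integers and let U be a nonempty open subset of ℝ^m. Let p_{ij} (for 1 ≤ i ≤ k, 1 ≤ j ≤ n) and q_1, …, q_n be linear partial differential operators with polynomial coefficients over ℝ in m variables. Then the following are equivalent: (1) for every point x⁰ ∈ ℝ^m and every n-tuple (u¹,…,uⁿ) of functions, each real-analytic on a neighborhood of x⁰, such that for every i = 1,…,k the function Σ_{j=1}^n p_{ij}[u^j] vanishes on a neighborhood of x⁰, the function Σ_{j=1}^n q_j[u^j] also vanishes on a neighborhood of x⁰; (1') the same statement with x⁰ restricted to range over U only; (2) there exist a nonzero polynomial w ∈ ℝ[x₁,…,x_m] and linear partial differential operators h_1, …, h_k with polynomial coefficients over ℝ such that for every j = 1,…,n and every polynomial function f : ℝ^m → ℝ one has w·(q_j[f]) = Σ_{i=1}^k h_i[p_{ij}[f]] as functions on ℝ^m. -/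
open scoped BigOperators
open Filter Topology MeasureTheory

/-- Partial derivative in coordinate direction `i`. -/
noncomputable def pderivOp {𝕜 : Type*} [NontriviallyNormedField 𝕜] {m : ℕ}
    (i : Fin m) (f : (Fin m → 𝕜) → 𝕜) : (Fin m → 𝕜) → 𝕜 :=
  fun x => fderiv 𝕜 f x (Pi.single i 1)

/-- Iterated partial derivative `∂^α`. -/
noncomputable def iterPDeriv {𝕜 : Type*} [NontriviallyNormedField 𝕜] {m : ℕ}
    (α : Fin m → ℕ) (f : (Fin m → 𝕜) → 𝕜) : (Fin m → 𝕜) → 𝕜 :=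
  (List.finRange m).foldr (fun i g => (pderivOp i)^[α i] g) f

/-- A linear partial differential operator with polynomial coefficients in `m` variables:
a finitely supported family of polynomials indexed by multi-indices. -/
def PDO (𝕜 : Type*) [CommSemiring 𝕜] (m : ℕ) :=
  (Fin m → ℕ) →₀ MvPolynomial (Fin m) 𝕜

/-- The action `p[u] = ∑_α p_α ⬝ ∂^α u` of a PDO on a function. -/
noncomputable def PDO.app {𝕜 : Type*} [NontriviallyNormedField 𝕜] {m : ℕ}
    (p : PDO 𝕜 m) (u : (Fin m → 𝕜) → 𝕜) : (Fin m → 𝕜) → 𝕜 :=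
  fun x => Finsupp.sum p (fun α c => MvPolynomial.eval x c * iterPDeriv α u x)


namespace WeylNull

section Words

variable {m : ℕ}

/-- The iterated partial derivative along a word of coordinate directions. -/
noncomputable def wordDeriv (l : List (Fin m)) (f : (Fin m → ℝ) → ℝ) : (Fin m → ℝ) → ℝ :=
  l.foldr pderivOp f

/-- The number of occurrences of each letter in a word. -/
def content (l : List (Fin m)) : Fin m → ℕ := fun i => l.count i

/-- The standard word with a given content. -/
def stdWord (α : Fin m → ℕ) : List (Fin m) :=
  (List.finRange m).flatMap fun i => List.replicate (α i) i

lemma foldr_stdWord {β : Type*} (T : Fin m → β → β) (α : Fin m → ℕ) (b : β) :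
    (stdWord α).foldr T b = (List.finRange m).foldr (fun i g => (T i)^[α i] g) b := by
  unfold stdWord
  induction List.finRange m with
  | nil => rfl
  | cons i L ih =>
    rw [List.flatMap_cons, List.foldr_append, ih, List.foldr_cons]
    generalize L.foldr _ b = c
    induction α i with
    | zero => rfl
    | succ k ihk => rw [List.replicate_succ, List.foldr_cons, ihk, Function.iterate_succ_apply']

lemma content_stdWord (α : Fin m → ℕ) : content (stdWord α) = α := by
  funext i
  simp only [content, stdWord, List.count_flatMap, List.count_replicate, Function.comp_def]
  rw [List.sum_map_eq_nsmul_single i]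
  · simp [List.count_eq_one_of_mem (List.nodup_finRange m) (List.mem_finRange i)]
  · intro j hj _
    simp [hj]

lemma perm_of_content_eq {l l' : List (Fin m)} (h : content l = content l') : l.Perm l' :=
  List.perm_iff_count.2 fun i => congrFun h i

lemma content_cons (i : Fin m) (l : List (Fin m)) :
    content (i :: l) = content l + Pi.single i 1 := by
  funext j
  rcases eq_or_ne j i with rfl | h
  · simp [content]
  · simp [content, h, List.count_cons_of_ne h.symm]

lemma content_perm {l l' : List (Fin m)} (h : l.Perm l') : content l = content l' :=
  funext fun i => h.count_eq i

lemma sum_content (l : List (Fin m)) : ∑ i, content l i = l.length := by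
  induction l with
  | nil => simp [content]
  | cons i l ih => simp [content_cons, Finset.sum_add_distrib, ih]

lemma iterPDeriv_eq_wordDeriv (α : Fin m → ℕ) (f : (Fin m → ℝ) → ℝ) :
    iterPDeriv α f = wordDeriv (stdWord α) f :=
  (foldr_stdWord pderivOp α f).symm

lemma analyticAt_pderivOp {f : (Fin m → ℝ) → ℝ} {x : Fin m → ℝ} (hf : AnalyticAt ℝ f x)
    (i : Fin m) : AnalyticAt ℝ (pderivOp i f) x :=
  ((ContinuousLinearMap.apply ℝ ℝ (Pi.single i (1 : ℝ) : Fin m → ℝ)).analyticAt _).comp hf.fderiv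

lemma analyticAt_wordDeriv {f : (Fin m → ℝ) → ℝ} {x : Fin m → ℝ} (hf : AnalyticAt ℝ f x)
    (l : List (Fin m)) : AnalyticAt ℝ (wordDeriv l f) x := by
  induction l with
  | nil => exact hf
  | cons i l ih => exact analyticAt_pderivOp ih i

lemma analyticAt_iterPDeriv {f : (Fin m → ℝ) → ℝ} {x : Fin m → ℝ} (hf : AnalyticAt ℝ f x)
    (α : Fin m → ℕ) : AnalyticAt ℝ (iterPDeriv α f) x := by
  rw [iterPDeriv_eq_wordDeriv]
  exact analyticAt_wordDeriv hf _

lemma pderivOp_congr {f g : (Fin m → ℝ) → ℝ} {x : Fin m → ℝ} (h : f =ᶠ[𝓝 x] g) (i : Fin m) :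
    pderivOp i f =ᶠ[𝓝 x] pderivOp i g :=
  (h.fderiv (𝕜 := ℝ)).mono fun y hy => by simp only [pderivOp, hy]

lemma wordDeriv_congr {f g : (Fin m → ℝ) → ℝ} {x : Fin m → ℝ} (h : f =ᶠ[𝓝 x] g)
    (l : List (Fin m)) : wordDeriv l f =ᶠ[𝓝 x] wordDeriv l g := by
  induction l with
  | nil => exact h
  | cons i l ih => exact pderivOp_congr ih i

lemma pderivOp_comm {f : (Fin m → ℝ) → ℝ} {x : Fin m → ℝ} (hf : AnalyticAt ℝ f x)
    (i j : Fin m) : pderivOp i (pderivOp j f) x = pderivOp j (pderivOp i f) x := by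
  have key : ∀ i j : Fin m, pderivOp i (pderivOp j f) x =
      fderiv ℝ (fderiv ℝ f) x (Pi.single i 1) (Pi.single j 1) := by
    intro i j
    unfold pderivOp
    rw [fderiv_clm_apply hf.fderiv.differentiableAt (differentiableAt_const _)]
    simp
  rw [key, key]
  exact (hf.contDiffAt (n := ⊤)).isSymmSndFDerivAt (by simp) _ _

lemma wordDeriv_perm {f : (Fin m → ℝ) → ℝ} {x : Fin m → ℝ} (hf : AnalyticAt ℝ f x)
    {l l' : List (Fin m)} (h : l.Perm l') : wordDeriv l f =ᶠ[𝓝 x] wordDeriv l' f := by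
  induction h with
  | nil => exact EventuallyEq.rfl
  | cons i _ ih => exact pderivOp_congr ih i
  | swap i j l =>
    filter_upwards [(analyticAt_wordDeriv hf l).eventually_analyticAt] with y hy
    exact pderivOp_comm hy j i
  | trans _ _ ih₁ ih₂ => exact ih₁.trans ih₂

lemma wordDeriv_eq_iterPDeriv {f : (Fin m → ℝ) → ℝ} {x : Fin m → ℝ} (hf : AnalyticAt ℝ f x)
    (l : List (Fin m)) : wordDeriv l f =ᶠ[𝓝 x] iterPDeriv (content l) f := by
  rw [iterPDeriv_eq_wordDeriv]
  exact wordDeriv_perm hf (perm_of_content_eq (content_stdWord _).symm)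

lemma pderivOp_iterPDeriv {f : (Fin m → ℝ) → ℝ} {x : Fin m → ℝ} (hf : AnalyticAt ℝ f x)
    (i : Fin m) (α : Fin m → ℕ) :
    pderivOp i (iterPDeriv α f) =ᶠ[𝓝 x] iterPDeriv (α + Pi.single i 1) f := by
  have h := wordDeriv_eq_iterPDeriv hf (i :: stdWord α)
  rwa [content_cons, content_stdWord, wordDeriv, List.foldr_cons, ← wordDeriv,
    ← iterPDeriv_eq_wordDeriv] at h

lemma wordDeriv_eq_iteratedFDeriv {f : (Fin m → ℝ) → ℝ} {x : Fin m → ℝ} (hf : AnalyticAt ℝ f x)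
    (l : List (Fin m)) : wordDeriv l f x =
      iteratedFDeriv ℝ l.length f x fun k => Pi.single (l.get k) 1 := by
  induction l generalizing x with
  | nil => simp [wordDeriv]
  | cons i l ih =>
    have h : wordDeriv l f =ᶠ[𝓝 x]
        fun y => iteratedFDeriv ℝ l.length f y fun k => Pi.single (l.get k) 1 := by
      filter_upwards [hf.eventually_analyticAt] with y hy using ih hy
    have hd : DifferentiableAt ℝ (iteratedFDeriv ℝ l.length f) x :=
      have hx : AnalyticOnNhd ℝ f {x} := fun y hy => Set.mem_singleton_iff.1 hy ▸ hf
      (hx.iteratedFDeriv _ x rfl).differentiableAt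
    have e : wordDeriv (i :: l) f x = fderiv ℝ
        (fun y => iteratedFDeriv ℝ l.length f y fun k => Pi.single (l.get k) 1) x
          (Pi.single i 1) := by
      rw [← h.fderiv_eq]
      rfl
    rw [e]
    simp only [List.length_cons]
    rw [iteratedFDeriv_succ_apply_left]
    rw [fderiv_continuousMultilinear_apply_const_apply hd]
    rfl

/-- An analytic function all of whose partial derivatives vanish at a point vanishes nearby. -/
lemma eventually_eq_zero_of_wordDeriv_eq_zero {f : (Fin m → ℝ) → ℝ} {x : Fin m → ℝ}
    (hf : AnalyticAt ℝ f x) (h : ∀ l, wordDeriv l f x = 0) : ∀ᶠ y in 𝓝 x, f y = 0 := by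
  have hz : ∀ d, iteratedFDeriv ℝ d f x = 0 := by
    intro d
    apply ContinuousMultilinearMap.toMultilinearMap_injective
    refine Module.Basis.ext_multilinear (fun _ => Pi.basisFun ℝ (Fin m)) fun v => ?_
    have := h (List.ofFn v)
    rw [wordDeriv_eq_iteratedFDeriv hf] at this
    simp only [Pi.basisFun_apply]
    have hlen : (List.ofFn v).length = d := List.length_ofFn
    have gen : ∀ (d' : ℕ) (e : d' = d) (w : Fin d' → Fin m), (∀ k, w k = v (Fin.cast e k)) →
        iteratedFDeriv ℝ d' f x (fun k => Pi.single (w k) 1) = 0 →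
        iteratedFDeriv ℝ d f x (fun k => Pi.single (v k) 1) = 0 := by
      rintro d' rfl w hw h0
      have : w = v := funext hw
      rwa [this] at h0
    exact gen _ hlen _ (fun k => by simp; rfl) this
  obtain ⟨p, r, hp⟩ := hf
  have hr := hp.r_pos
  have : ∀ᶠ y in 𝓝 x, y ∈ Metric.eball x r := Metric.eball_mem_nhds x hr
  filter_upwards [this] with y hy
  have hs := hp.hasSum_iteratedFDeriv (y := y - x) (by
    simpa [edist_eq_enorm_sub] using hy)
  simp only [hz, zero_apply, smul_zero, add_sub_cancel] at hs
  exact hs.unique hasSum_zero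

end Words

section PrescribedTaylor

variable {m : ℕ}

/-- The formal power series with prescribed partial derivatives at the origin. -/
noncomputable def taylorSeries (c : (Fin m → ℕ) → ℝ) :
    FormalMultilinearSeries ℝ (Fin m → ℝ) ℝ := fun d =>
  ∑ σ : Fin d → Fin m, (c (content (List.ofFn σ)) / d.factorial) •
    (ContinuousMultilinearMap.mkPiAlgebra ℝ (Fin d) ℝ).compContinuousLinearMap
      fun k => ContinuousLinearMap.proj (σ k)

lemma taylorSeries_apply_single (c : (Fin m → ℕ) → ℝ) {d : ℕ} (τ : Fin d → Fin m) :
    taylorSeries c d (fun k => Pi.single (τ k) 1) = c (content (List.ofFn τ)) / d.factorial := by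
  simp only [taylorSeries, _root_.sum_apply, _root_.smul_apply,
    ContinuousMultilinearMap.compContinuousLinearMap_apply,
    ContinuousMultilinearMap.mkPiAlgebra_apply,
    ContinuousLinearMap.proj_apply, smul_eq_mul]
  rw [Finset.sum_eq_single τ]
  · simp
  · intro σ _ hσ
    obtain ⟨k, hk⟩ := Function.ne_iff.1 hσ
    rw [Finset.prod_eq_zero (Finset.mem_univ k) (by simp [hk]), mul_zero]
  · simp

lemma norm_taylorSeries_le {c : (Fin m → ℕ) → ℝ} {C Λ : ℝ}
    (hc : ∀ α, |c α| ≤ C * Λ ^ (∑ i, α i) * (∑ i, α i).factorial) (d : ℕ) :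
    ‖taylorSeries c d‖ ≤ C * (m * Λ) ^ d := by
  calc ‖taylorSeries c d‖ ≤ ∑ σ : Fin d → Fin m, C * Λ ^ d := by
        refine norm_sum_le_of_le _ fun σ _ => ?_
        rw [norm_smul]
        have h1 : ‖(ContinuousMultilinearMap.mkPiAlgebra ℝ (Fin d) ℝ).compContinuousLinearMap
            fun k => (ContinuousLinearMap.proj (σ k) : (Fin m → ℝ) →L[ℝ] ℝ)‖ ≤ 1 := by
          refine (ContinuousMultilinearMap.norm_compContinuousLinearMap_le _ _).trans ?_
          rw [ContinuousMultilinearMap.norm_mkPiAlgebra, one_mul]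
          refine Finset.prod_le_one (fun _ _ => norm_nonneg _) fun k _ => ?_
          refine ContinuousLinearMap.opNorm_le_bound _ zero_le_one fun y => ?_
          simpa using norm_le_pi_norm y (σ k)
        have h2 : ‖c (content (List.ofFn σ)) / d.factorial‖ ≤ C * Λ ^ d := by
          have := hc (content (List.ofFn σ))
          rw [sum_content, List.length_ofFn] at this
          rw [norm_div, Real.norm_eq_abs, Real.norm_natCast, div_le_iff₀ (by positivity)]
          exact this
        calc _ ≤ C * Λ ^ d * 1 := mul_le_mul h2 h1 (norm_nonneg _) ((norm_nonneg _).trans h2)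
          _ = _ := mul_one _
    _ = C * (m * Λ) ^ d := by
        rw [Finset.sum_const, Finset.card_univ, Fintype.card_fun, Fintype.card_fin,
          Fintype.card_fin,
          nsmul_eq_mul, mul_pow]
        push_cast
        ring

/-- Partial derivatives of at most geometric-factorial growth are realised by an analytic
function. -/
lemma exists_analyticAt_iterPDeriv_eq (x₀ : Fin m → ℝ) {c : (Fin m → ℕ) → ℝ} {C Λ : ℝ}
    (hC : 0 ≤ C) (hΛ : 0 ≤ Λ)
    (hc : ∀ α, |c α| ≤ C * Λ ^ (∑ i, α i) * (∑ i, α i).factorial) :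
    ∃ u : (Fin m → ℝ) → ℝ, AnalyticAt ℝ u x₀ ∧ ∀ α, iterPDeriv α u x₀ = c α := by
  set p := taylorSeries c with hp
  have hpos : 0 < (m : ℝ) * Λ + 1 := by positivity
  have hr : 0 < p.radius := by
    refine lt_of_lt_of_le ?_ (p.le_radius_of_bound C (r := (Real.toNNReal (m * Λ + 1))⁻¹) ?_)
    · simpa using hpos
    · intro d
      rw [NNReal.coe_inv, Real.coe_toNNReal _ hpos.le]
      calc ‖p d‖ * ((m * Λ + 1)⁻¹) ^ d ≤ C * (m * Λ) ^ d * ((m * Λ + 1)⁻¹) ^ d := by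
            gcongr
            exact norm_taylorSeries_le hc d
        _ = C * (m * Λ / (m * Λ + 1)) ^ d := by rw [mul_assoc, ← mul_pow, div_eq_mul_inv]
        _ ≤ C * 1 := by
            gcongr
            refine pow_le_one₀ (by positivity) ?_
            rw [div_le_one hpos]
            linarith
        _ = C := mul_one C
  have hf := (p.hasFPowerSeriesOnBall hr).comp_sub x₀
  rw [zero_add] at hf
  refine ⟨fun x => p.sum (x - x₀), hf.analyticAt, fun α => ?_⟩
  rw [iterPDeriv_eq_wordDeriv, wordDeriv_eq_iteratedFDeriv hf.analyticAt,
    hf.iteratedFDeriv_eq_sum_of_completeSpace]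
  have : ∀ π : Equiv.Perm (Fin (stdWord α).length),
      p _ (fun k => Pi.single ((stdWord α).get (π k)) 1) =
        c α / ((stdWord α).length.factorial : ℝ) := by
    intro π
    have := taylorSeries_apply_single c (fun k => (stdWord α).get (π k))
    have e : content (List.ofFn fun k => (stdWord α).get (π k)) = α := by
      rw [← Function.comp_def, content_perm (Equiv.Perm.ofFn_comp_perm π (stdWord α).get),
        List.ofFn_get, content_stdWord]
    rw [hp, this, e]
  rw [Finset.sum_congr rfl fun π _ => this π, Finset.sum_const, Finset.card_univ,
    Fintype.card_perm, Fintype.card_fin, nsmul_eq_mul]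
  field_simp

end PrescribedTaylor

section Rows

variable {m n : ℕ}

/-- The index `(α, j)` stands for the derivative `∂^α` of the `j`-th unknown function. -/
abbrev Mon (m n : ℕ) := (Fin m → ℕ) × Fin n

/-- Rows of differential operators with polynomial coefficients. -/
abbrev Row (m n : ℕ) := Mon m n →₀ MvPolynomial (Fin m) ℝ

/-- Differentiate once more in direction `i`. -/
def shift (i : Fin m) (μ : Mon m n) : Mon m n := (μ.1 + Pi.single i 1, μ.2)

lemma shift_injective (i : Fin m) : Function.Injective (shift i : Mon m n → Mon m n) := by
  rintro ⟨α, j⟩ ⟨β, k⟩ h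
  simpa [shift] using h

lemma shift_comm (i i' : Fin m) (μ : Mon m n) : shift i (shift i' μ) = shift i' (shift i μ) := by
  simp only [shift, add_right_comm]

/-- Left multiplication of a row by `∂_i`. -/
noncomputable def rowD (i : Fin m) : Row m n →ₗ[ℝ] Row m n :=
  Finsupp.mapRange.linearMap (MvPolynomial.pderiv i).toLinearMap +
    Finsupp.lmapDomain _ ℝ (shift i)

lemma rowD_single (i : Fin m) (μ : Mon m n) (a : MvPolynomial (Fin m) ℝ) :
    rowD i (Finsupp.single μ a) =
      Finsupp.single μ (MvPolynomial.pderiv i a) + Finsupp.single (shift i μ) a := by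
  simp [rowD]

lemma rowD_apply (i : Fin m) (v : Row m n) (μ : Mon m n) :
    rowD i v μ = MvPolynomial.pderiv i (v μ) + Finsupp.mapDomain (shift i) v μ := by
  simp [rowD]

lemma pderiv_comm (i j : Fin m) (a : MvPolynomial (Fin m) ℝ) :
    MvPolynomial.pderiv i (MvPolynomial.pderiv j a) =
      MvPolynomial.pderiv j (MvPolynomial.pderiv i a) := by
  have h : ⁅(MvPolynomial.pderiv i : Derivation ℝ (MvPolynomial (Fin m) ℝ) _),
      MvPolynomial.pderiv (R := ℝ) j⁆ = 0 := by
    refine MvPolynomial.derivation_ext fun k => ?_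
    simp only [Derivation.commutator_apply, MvPolynomial.pderiv_X, Derivation.zero_apply]
    rcases eq_or_ne k i with rfl | hi <;> rcases eq_or_ne k j with rfl | hj <;> simp [*]
  have := congrArg (fun D => D a) h
  simpa [Derivation.commutator_apply, sub_eq_zero] using this

lemma rowD_comm (i j : Fin m) (v : Row m n) : rowD i (rowD j v) = rowD j (rowD i v) := by
  induction v using Finsupp.induction_linear with
  | zero => simp
  | add v w hv hw => simp [hv, hw]
  | single μ a =>
    simp only [rowD_single, map_add, pderiv_comm i j, shift_comm i j]
    abel

lemma rowD_smul (i : Fin m) (w : MvPolynomial (Fin m) ℝ) (v : Row m n) :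
    rowD i (w • v) = MvPolynomial.pderiv i w • v + w • rowD i v := by
  induction v using Finsupp.induction_linear with
  | zero => simp
  | add v w hv hw =>
    simp only [smul_add, map_add, hv, hw]
    abel
  | single μ a =>
    simp only [Finsupp.smul_single, smul_eq_mul, rowD_single, Derivation.leibniz,
      Finsupp.single_add, smul_add, mul_comm a]
    abel

/-- Left multiplication of a row by the derivatives along a word. -/
noncomputable def rowWord (l : List (Fin m)) : Row m n →ₗ[ℝ] Row m n :=
  l.foldr (fun i T => rowD i ∘ₗ T) LinearMap.id

@[simp] lemma rowWord_nil (v : Row m n) : rowWord [] v = v := rfl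

@[simp] lemma rowWord_cons (i : Fin m) (l : List (Fin m)) (v : Row m n) :
    rowWord (i :: l) v = rowD i (rowWord l v) := rfl

lemma rowWord_append (l l' : List (Fin m)) (v : Row m n) :
    rowWord (l ++ l') v = rowWord l (rowWord l' v) := by
  induction l with
  | nil => rfl
  | cons i l ih => simp [ih]

lemma rowWord_perm {l l' : List (Fin m)} (h : l.Perm l') (v : Row m n) :
    rowWord l v = rowWord l' v := by
  induction h with
  | nil => rfl
  | cons i _ ih => simp [ih]
  | swap i j l =>
    simp only [rowWord_cons]
    exact rowD_comm _ _ _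
  | trans _ _ ih₁ ih₂ => exact ih₁.trans ih₂

lemma rowD_rowWord_stdWord (i : Fin m) (α : Fin m → ℕ) (v : Row m n) :
    rowD i (rowWord (stdWord α) v) = rowWord (stdWord (α + Pi.single i 1)) v := by
  rw [← rowWord_cons]
  refine rowWord_perm (perm_of_content_eq ?_) v
  rw [content_cons, content_stdWord, content_stdWord]

/-- The pairing of a row with a family of values of the derivatives of the unknowns at `x`. -/
noncomputable def rowEval (x : Fin m → ℝ) (c : Mon m n → ℝ) : Row m n →ₗ[ℝ] ℝ :=
  Finsupp.lsum ℝ fun μ => c μ • (MvPolynomial.aeval x).toLinearMap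

@[simp] lemma rowEval_single (x : Fin m → ℝ) (c : Mon m n → ℝ) (μ : Mon m n)
    (a : MvPolynomial (Fin m) ℝ) :
    rowEval x c (Finsupp.single μ a) = MvPolynomial.eval x a * c μ := by
  simp [rowEval, mul_comm]

lemma rowEval_eq_sum (x : Fin m → ℝ) (c : Mon m n → ℝ) (v : Row m n) :
    rowEval x c v = ∑ μ ∈ v.support, MvPolynomial.eval x (v μ) * c μ := by
  conv_lhs => rw [← Finsupp.sum_single v]
  rw [Finsupp.sum, map_sum]
  exact Finset.sum_congr rfl fun μ _ => rowEval_single _ _ _ _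

lemma rowEval_smul (x : Fin m → ℝ) (c : Mon m n → ℝ) (w : MvPolynomial (Fin m) ℝ)
    (v : Row m n) : rowEval x c (w • v) = MvPolynomial.eval x w * rowEval x c v := by
  induction v using Finsupp.induction_linear with
  | zero => simp
  | add v w hv hw => simp [hv, hw, mul_add]
  | single μ a =>
    rw [Finsupp.smul_single, smul_eq_mul, rowEval_single, rowEval_single, map_mul, mul_assoc]

/-- The values at `x` of all derivatives of a tuple of functions. -/
noncomputable def jet (u : Fin n → (Fin m → ℝ) → ℝ) (x : Fin m → ℝ) : Mon m n → ℝ :=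
  fun μ => iterPDeriv μ.1 (u μ.2) x

/-- The action of a row on a tuple of functions. -/
noncomputable def rowApp (v : Row m n) (u : Fin n → (Fin m → ℝ) → ℝ) (x : Fin m → ℝ) : ℝ :=
  rowEval x (jet u x) v

lemma fderiv_eval_single (a : MvPolynomial (Fin m) ℝ) (i : Fin m) (x : Fin m → ℝ) :
    pderivOp i (fun y => MvPolynomial.eval y a) x =
      MvPolynomial.eval x (MvPolynomial.pderiv i a) := by
  have han : ∀ b : MvPolynomial (Fin m) ℝ,
      DifferentiableAt ℝ (fun y : Fin m → ℝ => MvPolynomial.eval y b) x := fun b =>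
    (AnalyticOnNhd.eval_mvPolynomial b x trivial).differentiableAt
  induction a using MvPolynomial.induction_on with
  | C r => simp [pderivOp]
  | add a b ha hb =>
    simp only [pderivOp, map_add] at *
    rw [fderiv_fun_add (han a) (han b), add_apply, ha, hb]
  | mul_X a j ha =>
    simp only [pderivOp, map_mul, MvPolynomial.eval_X] at *
    rw [fderiv_fun_mul (han a) (differentiableAt_apply j x)]
    have : fderiv ℝ (fun y : Fin m → ℝ => y j) x = ContinuousLinearMap.proj j :=
      (ContinuousLinearMap.proj (R := ℝ) (φ := fun _ : Fin m => ℝ) j).fderiv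
    rw [this]
    simp [ha, Pi.single_apply, MvPolynomial.pderiv_X]
    split_ifs <;> simp_all [eq_comm]

lemma analyticAt_rowApp (v : Row m n) {u : Fin n → (Fin m → ℝ) → ℝ} {x : Fin m → ℝ}
    (hu : ∀ j, AnalyticAt ℝ (u j) x) : AnalyticAt ℝ (rowApp v u) x := by
  have : rowApp v u = fun y => ∑ μ ∈ v.support, MvPolynomial.eval y (v μ) * jet u y μ :=
    funext fun y => rowEval_eq_sum y _ v
  rw [this]
  exact Finset.analyticAt_fun_sum _ fun μ _ =>
    (AnalyticOnNhd.eval_mvPolynomial (v μ) x trivial).mul (analyticAt_iterPDeriv (hu _) _)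

lemma pderivOp_rowApp (v : Row m n) {u : Fin n → (Fin m → ℝ) → ℝ} {x : Fin m → ℝ}
    (hu : ∀ j, AnalyticAt ℝ (u j) x) (i : Fin m) :
    pderivOp i (rowApp v u) x = rowApp (rowD i v) u x := by
  induction v using Finsupp.induction_linear with
  | zero =>
    have : rowApp (0 : Row m n) u = fun _ => 0 := by funext y; simp [rowApp]
    simp [this, pderivOp, rowApp]
  | add v w hv hw =>
    have : rowApp (v + w) u = fun y => rowApp v u y + rowApp w u y := by
      funext y; simp [rowApp]
    rw [this, pderivOp, fderiv_fun_add (analyticAt_rowApp v hu).differentiableAt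
      (analyticAt_rowApp w hu).differentiableAt, add_apply]
    simp only [pderivOp] at hv hw
    rw [hv, hw]
    simp [rowApp]
  | single μ a =>
    have : rowApp (Finsupp.single μ a) u =
        fun y => MvPolynomial.eval y a * iterPDeriv μ.1 (u μ.2) y := by
      funext y; simp [rowApp, jet]
    have h1 := fderiv_eval_single a i x
    have h2 := (pderivOp_iterPDeriv (hu μ.2) i μ.1).self_of_nhds
    simp only [pderivOp] at h1 h2
    rw [this, pderivOp, fderiv_fun_mul
      (AnalyticOnNhd.eval_mvPolynomial a x trivial).differentiableAt
      (analyticAt_iterPDeriv (hu _) _).differentiableAt]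
    simp only [add_apply, smul_apply, smul_eq_mul, h1, h2, rowD_single, rowApp, map_add,
      rowEval_single, jet, shift]
    ring

lemma wordDeriv_rowApp (v : Row m n) {u : Fin n → (Fin m → ℝ) → ℝ} {x : Fin m → ℝ}
    (hu : ∀ j, AnalyticAt ℝ (u j) x) (l : List (Fin m)) :
    wordDeriv l (rowApp v u) =ᶠ[𝓝 x] rowApp (rowWord l v) u := by
  induction l with
  | nil => exact EventuallyEq.rfl
  | cons i l ih =>
    refine (pderivOp_congr ih i).trans ?_
    have : ∀ᶠ y in 𝓝 x, ∀ j, AnalyticAt ℝ (u j) y :=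
      eventually_all.2 fun j => (hu j).eventually_analyticAt
    filter_upwards [this] with y hy using pderivOp_rowApp _ hy i

/-- The row of a tuple of operators. -/
noncomputable def toRow (p : Fin n → PDO ℝ m) : Row m n :=
  ∑ j, Finsupp.mapDomain (fun α => (α, j)) (p j : (Fin m → ℕ) →₀ MvPolynomial (Fin m) ℝ)

lemma rowApp_toRow (p : Fin n → PDO ℝ m) (u : Fin n → (Fin m → ℝ) → ℝ) (x : Fin m → ℝ) :
    rowApp (toRow p) u x = ∑ j, PDO.app (p j) (u j) x := by
  simp only [rowApp, toRow, map_sum]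
  refine Finset.sum_congr rfl fun j _ => ?_
  simp only [Finsupp.mapDomain, Finsupp.sum, map_sum, rowEval_single, jet, PDO.app]

/-- Left multiplication of a row by an operator. -/
noncomputable def opMul (h : PDO ℝ m) (v : Row m n) : Row m n :=
  Finsupp.sum h fun α a => a • rowWord (stdWord α) v

lemma app_rowApp (h : PDO ℝ m) (v : Row m n) {u : Fin n → (Fin m → ℝ) → ℝ} {x : Fin m → ℝ}
    (hu : ∀ j, AnalyticAt ℝ (u j) x) :
    PDO.app h (rowApp v u) x = rowApp (opMul h v) u x := by
  simp only [PDO.app, opMul, rowApp, Finsupp.sum, map_sum, rowEval_smul]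
  refine Finset.sum_congr rfl fun α _ => ?_
  rw [iterPDeriv_eq_wordDeriv]
  congr 1
  exact (wordDeriv_rowApp v hu _).self_of_nhds

lemma iterPDeriv_zero (α : Fin m → ℕ) : iterPDeriv α (fun _ : Fin m → ℝ => (0 : ℝ)) = 0 := by
  rw [iterPDeriv_eq_wordDeriv]
  induction stdWord α with
  | nil => rfl
  | cons i l ih =>
    change pderivOp i (wordDeriv l _) = 0
    rw [ih]
    funext x
    simp [pderivOp]

lemma app_zero_fun (h : PDO ℝ m) (x : Fin m → ℝ) : PDO.app h (fun _ => 0) x = 0 := by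
  simp only [PDO.app, iterPDeriv_zero, Pi.zero_apply, mul_zero, Finsupp.sum,
    Finset.sum_const_zero]

lemma app_congr (h : PDO ℝ m) {f g : (Fin m → ℝ) → ℝ} {x : Fin m → ℝ} (hfg : f =ᶠ[𝓝 x] g) :
    PDO.app h f x = PDO.app h g x := by
  simp only [PDO.app, iterPDeriv_eq_wordDeriv, (wordDeriv_congr hfg _).self_of_nhds]

end Rows

section Faithful

variable {m n : ℕ}

lemma foldr_pderiv_monomial (l : List (Fin m)) (s : Fin m →₀ ℕ) (a : ℝ) :
    l.foldr (fun i g => MvPolynomial.pderiv i g) (MvPolynomial.monomial s a) =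
      MvPolynomial.monomial (s - Finsupp.equivFunOnFinite.symm (content l))
        (a * ∏ i, ((s i).descFactorial (content l i) : ℝ)) := by
  induction l with
  | nil =>
    have : Finsupp.equivFunOnFinite.symm (content ([] : List (Fin m))) = 0 := by
      ext i; simp [content]
    simp [this, content]
  | cons i l ih =>
    have hexp : s - Finsupp.equivFunOnFinite.symm (content l) - Finsupp.single i 1 =
        s - Finsupp.equivFunOnFinite.symm (content l + Pi.single i 1) := by
      ext j
      rcases eq_or_ne j i with rfl | h
      · simp [Nat.sub_sub]
      · simp [h, Finsupp.single_eq_of_ne h]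
    have hcoeff : ∏ j, ((s j).descFactorial ((content l + Pi.single i 1 : Fin m → ℕ) j) : ℝ) =
        (∏ j, ((s j).descFactorial (content l j) : ℝ)) *
          ((s - Finsupp.equivFunOnFinite.symm (content l) : Fin m →₀ ℕ) i : ℝ) := by
      rw [← Finset.mul_prod_erase _ _ (Finset.mem_univ i),
        ← Finset.mul_prod_erase _ _ (Finset.mem_univ i)]
      have herase : ∀ j ∈ Finset.univ.erase i,
          ((s j).descFactorial ((content l + Pi.single i 1 : Fin m → ℕ) j) : ℝ) =
            ((s j).descFactorial (content l j) : ℝ) := by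
        intro j hj
        simp [Finset.ne_of_mem_erase hj]
      rw [Finset.prod_congr rfl herase]
      simp only [Pi.add_apply, Pi.single_eq_same, Nat.descFactorial_succ, Finsupp.tsub_apply,
        Finsupp.equivFunOnFinite_symm_apply_apply]
      push_cast
      ring
    rw [List.foldr_cons, ih, MvPolynomial.pderiv_monomial, content_cons, hexp, hcoeff, mul_assoc]

lemma iterPDeriv_eval (α : Fin m → ℕ) (g : MvPolynomial (Fin m) ℝ) :
    iterPDeriv α (fun y => MvPolynomial.eval y g) = fun y => MvPolynomial.eval y
      ((stdWord α).foldr (fun i g => MvPolynomial.pderiv i g) g) := by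
  rw [iterPDeriv_eq_wordDeriv]
  induction stdWord α with
  | nil => rfl
  | cons i l ih =>
    change pderivOp i (wordDeriv l _) = _
    rw [ih]
    funext x
    exact fderiv_eval_single _ i x

/-- A row annihilating all polynomial tuples is zero. -/
lemma eq_zero_of_rowApp_eq_zero {v : Row m n}
    (h : ∀ (j : Fin n) (g : MvPolynomial (Fin m) ℝ) (x : Fin m → ℝ),
      rowApp v (Pi.single j fun y => MvPolynomial.eval y g) x = 0) : v = 0 := by
  by_contra hv
  obtain ⟨⟨α, j⟩, hμ, hmin⟩ := Finset.exists_min_image v.support (fun ν => ∑ i, ν.1 i)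
    (Finsupp.support_nonempty_iff.2 hv)
  refine Finsupp.mem_support_iff.1 hμ (MvPolynomial.funext fun x => ?_)
  set s : Fin m →₀ ℕ := Finsupp.equivFunOnFinite.symm α with hs
  have hsα : ∀ i, s i = α i := fun i => rfl
  have hx := h j (MvPolynomial.monomial s 1) x
  rw [rowApp, rowEval_eq_sum, Finset.sum_eq_single (α, j)] at hx
  · simp only [jet, Pi.single_eq_same] at hx
    rw [iterPDeriv_eval, foldr_pderiv_monomial, content_stdWord, ← hs, tsub_self] at hx
    simp only [one_mul, MvPolynomial.eval_monomial, Finsupp.prod_zero_index, mul_one] at hx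
    rw [map_zero]
    refine (mul_eq_zero.1 hx).resolve_right (Finset.prod_ne_zero_iff.2 fun i _ => ?_)
    rw [hsα, Nat.descFactorial_self]
    positivity
  · rintro ⟨β, j'⟩ hβ hne
    rcases eq_or_ne j' j with rfl | hj
    · have : ∃ i, α i < β i := by
        by_contra! hle
        have hsum := hmin _ hβ
        refine hne (Prod.ext ?_ rfl)
        funext i
        refine le_antisymm (hle i) (not_lt.1 fun hlt => ?_)
        exact absurd (Finset.sum_lt_sum (fun i _ => hle i) ⟨i, Finset.mem_univ i, hlt⟩)
          (not_lt.2 hsum)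
      obtain ⟨i, hi⟩ := this
      have hz : ∏ i, ((s i).descFactorial (content (stdWord β) i) : ℝ) = 0 := by
        refine Finset.prod_eq_zero (Finset.mem_univ i) ?_
        rw [content_stdWord, hsα, Nat.descFactorial_eq_zero_iff_lt.2 hi, Nat.cast_zero]
      simp only [jet, Pi.single_eq_same]
      rw [iterPDeriv_eval, foldr_pderiv_monomial, hz, mul_zero]
      simp
    · have : jet (Pi.single j fun y => MvPolynomial.eval y (MvPolynomial.monomial s 1)) x (β, j')
          = 0 := by
        simp only [jet, Pi.single_eq_of_ne hj]
        exact congrFun (iterPDeriv_zero β) x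
      rw [this, mul_zero]
  · exact fun hn => absurd hμ hn

lemma rowApp_toRow_single (p : Fin n → PDO ℝ m) (j : Fin n) (f : (Fin m → ℝ) → ℝ)
    (x : Fin m → ℝ) : rowApp (toRow p) (Pi.single j f) x = PDO.app (p j) f x := by
  rw [rowApp_toRow, Finset.sum_eq_single j]
  · rw [Pi.single_eq_same]
  · intro j' _ hj
    rw [Pi.single_eq_of_ne hj]
    exact app_zero_fun _ x
  · simp

lemma analyticAt_single_eval (j : Fin n) (g : MvPolynomial (Fin m) ℝ) (x : Fin m → ℝ)
    (j' : Fin n) : AnalyticAt ℝ ((Pi.single j fun y => MvPolynomial.eval y g :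
      Fin n → (Fin m → ℝ) → ℝ) j') x := by
  rcases eq_or_ne j' j with rfl | h
  · rw [Pi.single_eq_same]
    exact AnalyticOnNhd.eval_mvPolynomial g x trivial
  · rw [Pi.single_eq_of_ne h]
    exact analyticAt_const

/-- The action on polynomials detects membership in the left module spanned by the rows. -/
lemma forall_eval_iff_smul_toRow_eq {k : ℕ} (p : Fin k → Fin n → PDO ℝ m) (q : Fin n → PDO ℝ m)
    (w : MvPolynomial (Fin m) ℝ) (h : Fin k → PDO ℝ m) :
    (∀ (j : Fin n) (g : MvPolynomial (Fin m) ℝ) (x : Fin m → ℝ),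
      MvPolynomial.eval x w * PDO.app (q j) (fun y => MvPolynomial.eval y g) x =
        ∑ i, PDO.app (h i) (PDO.app (p i j) (fun y => MvPolynomial.eval y g)) x) ↔
    w • toRow q = ∑ i, opMul (h i) (toRow (p i)) := by
  have key : ∀ (j : Fin n) (g : MvPolynomial (Fin m) ℝ) (x : Fin m → ℝ),
      rowApp (w • toRow q - ∑ i, opMul (h i) (toRow (p i)))
        (Pi.single j fun y => MvPolynomial.eval y g) x =
      MvPolynomial.eval x w * PDO.app (q j) (fun y => MvPolynomial.eval y g) x -
        ∑ i, PDO.app (h i) (PDO.app (p i j) (fun y => MvPolynomial.eval y g)) x := by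
    intro j g x
    rw [← rowApp_toRow_single q, rowApp, map_sub, rowEval_smul, map_sum]
    congr 1
    refine Finset.sum_congr rfl fun i _ => ?_
    have := app_rowApp (h i) (toRow (p i)) (analyticAt_single_eval j g x)
    rw [← rowApp, ← this]
    congr 1
    funext y
    exact rowApp_toRow_single _ _ _ _
  constructor
  · intro H
    refine sub_eq_zero.1 (eq_zero_of_rowApp_eq_zero fun j g x => ?_)
    rw [key, H, sub_self]
  · intro H j g x
    rw [← sub_eq_zero, ← key, H, sub_self]
    simp [rowApp]

/-- The left module generated by a finite family of rows. -/
noncomputable def rowModule {k : ℕ} (P : Fin k → Row m n) :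
    Submodule (MvPolynomial (Fin m) ℝ) (Row m n) :=
  Submodule.span _ (Set.range fun t : Fin k × (Fin m → ℕ) => rowWord (stdWord t.2) (P t.1))

lemma subset_rowModule {k : ℕ} (P : Fin k → Row m n) (i : Fin k) : P i ∈ rowModule P := by
  refine Submodule.subset_span ⟨(i, 0), ?_⟩
  have : stdWord (0 : Fin m → ℕ) = [] :=
    List.perm_nil.1 (perm_of_content_eq (by rw [content_stdWord]; funext i; simp [content]))
  simp [this]

lemma rowD_mem_rowModule {k : ℕ} {P : Fin k → Row m n} (i : Fin m) {v : Row m n}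
    (hv : v ∈ rowModule P) : rowD i v ∈ rowModule P := by
  induction hv using Submodule.span_induction with
  | mem v hv =>
    obtain ⟨⟨j, α⟩, rfl⟩ := hv
    refine Submodule.subset_span ⟨(j, α + Pi.single i 1), ?_⟩
    exact (rowD_rowWord_stdWord i α (P j)).symm
  | zero => simp
  | add v w _ _ hv hw => rw [map_add]; exact add_mem hv hw
  | smul a v hv' hv =>
    rw [rowD_smul]
    exact add_mem (Submodule.smul_mem _ _ hv') (Submodule.smul_mem _ _ hv)

lemma exists_eq_sum_opMul {k : ℕ} {P : Fin k → Row m n} {v : Row m n} (hv : v ∈ rowModule P) :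
    ∃ h : Fin k → PDO ℝ m, v = ∑ i, opMul (h i) (P i) := by
  obtain ⟨c, rfl⟩ := Finsupp.mem_span_range_iff_exists_finsupp.1 hv
  refine ⟨fun i => c.curry i, ?_⟩
  have := Finsupp.sum_curry_index c (fun i α a => a • rowWord (stdWord α) (P i))
  rw [← this, Finsupp.sum_fintype]
  · rfl
  · intro i
    simp

/-- Saturation of a submodule with respect to nonzero polynomials. -/
def saturation (N : Submodule (MvPolynomial (Fin m) ℝ) (Row m n)) :
    Submodule (MvPolynomial (Fin m) ℝ) (Row m n) where
  carrier := {v | ∃ w : MvPolynomial (Fin m) ℝ, w ≠ 0 ∧ w • v ∈ N}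
  zero_mem' := ⟨1, one_ne_zero, by simp⟩
  add_mem' := by
    rintro v v' ⟨w, hw, hv⟩ ⟨w', hw', hv'⟩
    refine ⟨w * w', mul_ne_zero hw hw', ?_⟩
    rw [smul_add]
    refine add_mem ?_ ?_
    · rw [mul_comm, mul_smul]
      exact N.smul_mem _ hv
    · rw [mul_smul]
      exact N.smul_mem _ hv'
  smul_mem' := by
    rintro a v ⟨w, hw, hv⟩
    refine ⟨w, hw, ?_⟩
    rw [smul_comm]
    exact N.smul_mem _ hv

lemma mem_saturation {N : Submodule (MvPolynomial (Fin m) ℝ) (Row m n)} {v : Row m n} :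
    v ∈ saturation N ↔ ∃ w : MvPolynomial (Fin m) ℝ, w ≠ 0 ∧ w • v ∈ N := Iff.rfl

lemma mem_saturation_of_smul_mem {N : Submodule (MvPolynomial (Fin m) ℝ) (Row m n)} {v : Row m n}
    {w : MvPolynomial (Fin m) ℝ} (hw : w ≠ 0) (h : w • v ∈ saturation N) : v ∈ saturation N := by
  obtain ⟨w', hw', h'⟩ := h
  exact ⟨w' * w, mul_ne_zero hw' hw, by rwa [mul_smul]⟩

lemma le_saturation (N : Submodule (MvPolynomial (Fin m) ℝ) (Row m n)) : N ≤ saturation N :=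
  fun v hv => ⟨1, one_ne_zero, by simpa⟩

lemma rowD_mem_saturation {N : Submodule (MvPolynomial (Fin m) ℝ) (Row m n)}
    (hN : ∀ i, ∀ v ∈ N, rowD i v ∈ N) (i : Fin m) {v : Row m n} (hv : v ∈ saturation N) :
    rowD i v ∈ saturation N := by
  obtain ⟨w, hw, hv⟩ := hv
  refine ⟨w * w, mul_ne_zero hw hw, ?_⟩
  have h1 := N.smul_mem w (hN i _ hv)
  rw [rowD_smul, smul_add, smul_comm, ← mul_smul w w] at h1
  exact (N.add_mem_iff_right (N.smul_mem _ hv)).1 h1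

lemma rowWord_mem {N : Submodule (MvPolynomial (Fin m) ℝ) (Row m n)}
    (hN : ∀ i, ∀ v ∈ N, rowD i v ∈ N) (l : List (Fin m)) {v : Row m n} (hv : v ∈ N) :
    rowWord l v ∈ N := by
  induction l with
  | nil => exact hv
  | cons i l ih => exact hN i _ ih

end Faithful

section Leads

variable {m n : ℕ}

/-- The order of the derivative `∂^α`. -/
def deg (μ : Mon m n) : ℕ := ∑ i, μ.1 i

/-- The prime attached to a differentiation direction or to an unknown function. -/
noncomputable def basePrime : Fin m ⊕ Fin n → ℕ :=
  Sum.elim (fun i => Nat.nth Nat.Prime i) (fun j => Nat.nth Nat.Prime (m + j))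

lemma prime_basePrime (t : Fin m ⊕ Fin n) : (basePrime t).Prime := by
  rcases t with i | j <;> exact Nat.prime_nth_prime _

lemma basePrime_injective : Function.Injective (basePrime : Fin m ⊕ Fin n → ℕ) := by
  have h := Nat.nth_injective Nat.infinite_setOfPred_prime
  rintro (i | i) (j | j) hij
  · exact congrArg _ (Fin.ext (h hij))
  · have := h hij
    omega
  · have := h hij
    omega
  · have := h hij
    exact congrArg _ (Fin.ext (by omega))

/-- A multiplicative encoding of the index set by natural numbers. -/
noncomputable def label (μ : Mon m n) : ℕ :=
  (∏ i, basePrime (n := n) (Sum.inl i) ^ μ.1 i) * basePrime (m := m) (Sum.inr μ.2)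

lemma label_pos (μ : Mon m n) : 0 < label μ :=
  Nat.mul_pos (Finset.prod_pos fun _ _ => pow_pos (prime_basePrime _).pos _)
    (prime_basePrime _).pos

lemma label_shift (i : Fin m) (μ : Mon m n) :
    label (shift i μ) = basePrime (n := n) (Sum.inl i) * label μ := by
  simp only [label, shift, Pi.add_apply, pow_add, Finset.prod_mul_distrib]
  rw [Finset.prod_eq_single (M := ℕ) (f := fun x => basePrime (n := n) (Sum.inl x) ^
    (Pi.single i 1 : Fin m → ℕ) x) i]
  · simp only [Pi.single_eq_same, pow_one]
    ring
  · intro j _ hj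
    simp [hj]
  · simp

lemma label_injective : Function.Injective (label : Mon m n → ℕ) := by
  have hfac : ∀ (μ : Mon m n) (t : Fin m ⊕ Fin n), (label μ).factorization (basePrime t) =
      Sum.elim μ.1 (Pi.single μ.2 1) t := by
    intro μ t
    have hne : ∀ s : Fin m ⊕ Fin n, basePrime s ≠ 0 := fun s => (prime_basePrime s).ne_zero
    rw [label, Nat.factorization_mul
      (Finset.prod_ne_zero_iff.2 fun i _ => pow_ne_zero _ (hne _)) (hne _),
      Nat.factorization_prod fun i _ => pow_ne_zero _ (hne _)]
    simp only [Nat.factorization_pow, (prime_basePrime _).factorization, Finsupp.add_apply,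
      Finsupp.finsetSum_apply, Finsupp.smul_apply, Finsupp.single_apply,
      basePrime_injective.eq_iff]
    rcases t with i | j
    · simp
    · simp [Pi.single_apply, eq_comm]
  intro μ ν h
  have h' : ∀ t : Fin m ⊕ Fin n, Sum.elim μ.1 (Pi.single μ.2 1) t =
      (Sum.elim ν.1 (Pi.single ν.2 1) t : ℕ) := fun t => by rw [← hfac, ← hfac, h]
  refine Prod.ext (funext fun i => h' (Sum.inl i)) ?_
  by_contra hne
  simpa [hne] using h' (Sum.inr μ.2)

/-- The position in a well-ordering of the index set. -/
noncomputable def key (μ : Mon m n) : ℕ ×ₗ ℕ := toLex (deg μ, label μ)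

lemma key_injective : Function.Injective (key : Mon m n → ℕ ×ₗ ℕ) := fun _ _ h =>
  label_injective (Prod.ext_iff.1 (toLex.injective h)).2

lemma key_lt_iff {μ ν : Mon m n} :
    key μ < key ν ↔ deg μ < deg ν ∨ deg μ = deg ν ∧ label μ < label ν :=
  Prod.Lex.toLex_lt_toLex

lemma deg_le_of_key_le {μ ν : Mon m n} (h : key μ ≤ key ν) : deg μ ≤ deg ν := by
  rcases h.lt_or_eq with h | h
  · rcases key_lt_iff.1 h with h | h
    · exact h.le
    · exact h.1.le
  · rw [key_injective h]

lemma deg_shift (i : Fin m) (μ : Mon m n) : deg (shift i μ) = deg μ + 1 := by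
  simp [deg, shift, Finset.sum_add_distrib]

lemma key_lt_shift (i : Fin m) (μ : Mon m n) : key μ < key (shift i μ) :=
  key_lt_iff.2 (Or.inl (by rw [deg_shift]; exact Nat.lt_succ_self _))

lemma key_shift_lt (i : Fin m) {μ ν : Mon m n} (h : key μ < key ν) :
    key (shift i μ) < key (shift i ν) := by
  simp only [key_lt_iff, deg_shift, label_shift, add_lt_add_iff_right, add_left_inj] at h ⊢
  exact h.imp_right fun h => ⟨h.1, Nat.mul_lt_mul_of_pos_left h.2 (prime_basePrime _).pos⟩

lemma key_shift_le (i : Fin m) {μ ν : Mon m n} (h : key μ ≤ key ν) :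
    key (shift i μ) ≤ key (shift i ν) := by
  rcases h.lt_or_eq with h | h
  · exact (key_shift_lt i h).le
  · rw [key_injective h]

/-- The derivative obtained by differentiating further along a word. -/
def shiftWord (l : List (Fin m)) (μ : Mon m n) : Mon m n := (μ.1 + content l, μ.2)

lemma shiftWord_cons (i : Fin m) (l : List (Fin m)) (μ : Mon m n) :
    shiftWord (i :: l) μ = shift i (shiftWord l μ) := by
  simp [shiftWord, shift, content_cons, add_assoc]

lemma shiftWord_nil (μ : Mon m n) : shiftWord [] μ = μ := by
  refine Prod.ext (funext fun i => ?_) rfl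
  simp [shiftWord, content]

lemma deg_shiftWord (l : List (Fin m)) (μ : Mon m n) :
    deg (shiftWord l μ) = deg μ + l.length := by
  simp [deg, shiftWord, Finset.sum_add_distrib, sum_content]

/-- `μ` is the largest index at which `v` does not vanish. -/
def IsLead {R : Type*} [Zero R] (v : Mon m n →₀ R) (μ : Mon m n) : Prop :=
  v μ ≠ 0 ∧ ∀ ν, v ν ≠ 0 → key ν ≤ key μ

lemma exists_isLead {R : Type*} [Zero R] {v : Mon m n →₀ R} (hv : v ≠ 0) : ∃ μ, IsLead v μ := by
  obtain ⟨μ, hμ, hmax⟩ := Finset.exists_max_image v.support key (Finsupp.support_nonempty_iff.2 hv)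
  exact ⟨μ, Finsupp.mem_support_iff.1 hμ, fun ν hν => hmax ν (Finsupp.mem_support_iff.2 hν)⟩

lemma IsLead.rowD {v : Row m n} {μ : Mon m n} (h : IsLead v μ) (i : Fin m) :
    IsLead (rowD i v) (shift i μ) ∧ rowD i v (shift i μ) = v μ := by
  have hval : WeylNull.rowD i v (shift i μ) = v μ := by
    have hz : v (shift i μ) = 0 := by
      by_contra hne
      exact absurd (h.2 _ hne) (not_le.2 (key_lt_shift i μ))
    rw [rowD_apply, hz, map_zero, zero_add, Finsupp.mapDomain_apply (shift_injective i)]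
  refine ⟨⟨hval ▸ h.1, fun ν hν => ?_⟩, hval⟩
  rw [rowD_apply] at hν
  by_cases hvν : v ν = 0
  · rw [hvν, map_zero, zero_add] at hν
    by_cases hr : ν ∈ Set.range (shift i)
    · obtain ⟨ν, rfl⟩ := hr
      rw [Finsupp.mapDomain_apply (shift_injective i)] at hν
      exact key_shift_le i (h.2 ν hν)
    · exact absurd (Finsupp.mapDomain_of_notMem_range _ _ hr) hν
  · exact (h.2 ν hvν).trans (key_lt_shift i μ).le

lemma IsLead.rowWord {v : Row m n} {μ : Mon m n} (h : IsLead v μ) (l : List (Fin m)) :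
    IsLead (rowWord l v) (shiftWord l μ) ∧ rowWord l v (shiftWord l μ) = v μ := by
  induction l with
  | nil => simpa [shiftWord_nil] using h
  | cons i l ih =>
    rw [shiftWord_cons, rowWord_cons, ← ih.2]
    exact ih.1.rowD i

/-- Dickson's lemma for leads of rows. -/
lemma exists_finset_leads (N : Submodule (MvPolynomial (Fin m) ℝ) (Row m n)) :
    ∃ G : Finset (Row m n × Mon m n), (∀ g ∈ G, g.1 ∈ N ∧ IsLead g.1 g.2) ∧
      ∀ v ∈ N, ∀ μ, IsLead v μ → ∃ g ∈ G, ∃ l, μ = shiftWord l g.2 := by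
  classical
  let E : Fin n → Set (Fin m → ℕ) := fun j => {α | ∃ v ∈ N, IsLead v (α, j)}
  have hfin : ∀ j, {α | Minimal (· ∈ E j) α}.Finite := fun j =>
    WellQuasiOrderedLE.finite_of_isAntichain (setOfPred_minimal_antichain _)
  have hex : ∀ t : Fin n × (Fin m → ℕ), ∃ v : Row m n,
      t.2 ∈ E t.1 → v ∈ N ∧ IsLead v (t.2, t.1) := by
    intro t
    by_cases h : t.2 ∈ E t.1
    · obtain ⟨v, hv⟩ := h
      exact ⟨v, fun _ => hv⟩
    · exact ⟨0, fun h' => absurd h' h⟩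
  choose f hf using hex
  refine ⟨Finset.univ.biUnion fun j => (hfin j).toFinset.image fun α => (f (j, α), (α, j)), ?_, ?_⟩
  · intro g hg
    simp only [Finset.mem_biUnion, Finset.mem_image, Set.Finite.mem_toFinset] at hg
    obtain ⟨j, -, α, hα, rfl⟩ := hg
    exact hf (j, α) hα.1
  · rintro v hv ⟨α, j⟩ hα
    obtain ⟨β, hβα, hβ⟩ := exists_minimal_le_of_wellFoundedLT (· ∈ E j) α ⟨v, hv, hα⟩
    refine ⟨(f (j, β), (β, j)), ?_, stdWord (α - β), ?_⟩
    · simp only [Finset.mem_biUnion, Finset.mem_image, Set.Finite.mem_toFinset]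
      exact ⟨j, Finset.mem_univ _, β, hβ, rfl⟩
    · simp only [shiftWord, content_stdWord]
      rw [add_tsub_cancel_of_le hβα]

lemma eq_top_of_isLead {R : Type*} [CommRing R] (K : Submodule R (Mon m n →₀ R))
    (h : ∀ μ, Finsupp.single μ 1 ∈ K ∨ ∃ v ∈ K, IsLead v μ ∧ ∀ x, v μ • x ∈ K → x ∈ K) :
    K = ⊤ := by
  have hsmul : ∀ (ν : Mon m n) (a : R), Finsupp.single ν 1 ∈ K → Finsupp.single ν a ∈ K := by
    intro ν a hν
    have := K.smul_mem a hν
    rwa [Finsupp.smul_single, smul_eq_mul, mul_one] at this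
  have hsingle : ∀ μ : Mon m n, Finsupp.single μ 1 ∈ K := by
    intro μ
    induction hk : key μ using WellFoundedLT.induction generalizing μ with
    | ind k ih =>
      subst hk
      rcases h μ with hμ | ⟨v, hv, hlead, hcancel⟩
      · exact hμ
      · refine hcancel _ ?_
        have herase : v.erase μ ∈ K := by
          rw [← Finsupp.sum_single (v.erase μ)]
          refine Submodule.sum_mem _ fun ν hν => hsmul _ _ ?_
          rw [Finsupp.support_erase, Finset.mem_erase, Finsupp.mem_support_iff] at hν
          exact ih _ (lt_of_le_of_ne (hlead.2 ν hν.2) fun he => hν.1 (key_injective he)) ν rfl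
        have := K.sub_mem hv herase
        rw [← Finsupp.single_add_erase μ v, Finsupp.erase_add, Finsupp.erase_single, zero_add,
          Finsupp.erase_idem, add_sub_cancel_right] at this
        rwa [Finsupp.smul_single, smul_eq_mul, mul_one]
  refine eq_top_iff.2 fun v _ => ?_
  rw [← Finsupp.sum_single v]
  exact Submodule.sum_mem _ fun ν _ => hsmul _ _ (hsingle ν)

end Leads

section Growth

variable {m n : ℕ}

/-- The derivative of a polynomial along a word. -/
noncomputable def polyWord (l : List (Fin m)) (a : MvPolynomial (Fin m) ℝ) :
    MvPolynomial (Fin m) ℝ :=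
  l.foldr (fun i g => MvPolynomial.pderiv i g) a

lemma polyWord_append_singleton (l : List (Fin m)) (i : Fin m) (a : MvPolynomial (Fin m) ℝ) :
    polyWord (l ++ [i]) a = polyWord l (MvPolynomial.pderiv i a) := by
  simp [polyWord]

lemma polyWord_add (l : List (Fin m)) (a b : MvPolynomial (Fin m) ℝ) :
    polyWord l (a + b) = polyWord l a + polyWord l b := by
  induction l with
  | nil => rfl
  | cons i l ih =>
    simp only [polyWord, List.foldr_cons] at ih ⊢
    rw [ih, map_add]

lemma polyWord_cons_sub_C (i : Fin m) (l : List (Fin m)) (a : MvPolynomial (Fin m) ℝ) (r : ℝ) :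
    polyWord (i :: l) (a - MvPolynomial.C r) = polyWord (i :: l) a := by
  have h : ∀ l : List (Fin m), ∀ i, polyWord (i :: l) (MvPolynomial.C r) = 0 := by
    intro l
    induction l with
    | nil => intro i; simp [polyWord]
    | cons j l ih =>
      intro i
      have := ih j
      simp only [polyWord, List.foldr_cons] at this ⊢
      rw [this, map_zero]
  have h2 := polyWord_add (i :: l) (a - MvPolynomial.C r) (MvPolynomial.C r)
  rw [sub_add_cancel, h, add_zero] at h2
  exact h2.symm

lemma exists_bound_polyWord (x : Fin m → ℝ) (a : MvPolynomial (Fin m) ℝ) :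
    ∃ C, 0 ≤ C ∧ ∀ l, |MvPolynomial.eval x (polyWord l a)| ≤ C := by
  induction a using MvPolynomial.induction_on' with
  | monomial s r =>
    let f : (Fin m → ℕ) → ℝ := fun t => MvPolynomial.eval x
      (MvPolynomial.monomial (s - Finsupp.equivFunOnFinite.symm t)
        (r * ∏ i, ((s i).descFactorial (t i) : ℝ)))
    refine ⟨∑ t ∈ Finset.Iic (s : Fin m → ℕ), |f t|,
      Finset.sum_nonneg fun _ _ => abs_nonneg _, fun l => ?_⟩
    have hl : MvPolynomial.eval x (polyWord l (MvPolynomial.monomial s r)) = f (content l) := by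
      rw [polyWord, foldr_pderiv_monomial]
    rw [hl]
    by_cases hle : content l ≤ s
    · exact Finset.single_le_sum (f := fun t => |f t|) (fun _ _ => abs_nonneg _)
        (Finset.mem_Iic.2 hle)
    · obtain ⟨i, hi⟩ : ∃ i, s i < content l i := by simpa [Pi.le_def] using hle
      have hz : ∏ i, ((s i).descFactorial (content l i) : ℝ) = 0 := by
        refine Finset.prod_eq_zero (Finset.mem_univ i) ?_
        rw [Nat.descFactorial_eq_zero_iff_lt.2 hi, Nat.cast_zero]
      simp only [f, hz, mul_zero, map_zero, abs_zero]
      exact Finset.sum_nonneg fun _ _ => abs_nonneg _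
  | add a b ha hb =>
    obtain ⟨A, hA, ha⟩ := ha
    obtain ⟨B, hB, hb⟩ := hb
    refine ⟨A + B, add_nonneg hA hB, fun l => ?_⟩
    rw [polyWord_add, map_add]
    exact (abs_add_le _ _).trans (add_le_add (ha l) (hb l))

/-- The combinatorial factor in the estimate for a differentiated row. -/
noncomputable def growthFactor (d b : ℕ) : ℝ := (1 + d / (d + b)) * (d + b).factorial

lemma growthFactor_zero (b : ℕ) : growthFactor 0 b = b.factorial := by
  simp [growthFactor]

lemma growthFactor_le (d b : ℕ) : growthFactor d b ≤ 2 * (d + b).factorial := by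
  refine mul_le_mul_of_nonneg_right ?_ (by positivity)
  have : (d : ℝ) / (d + b) ≤ 1 := div_le_one_of_le₀ (by simp) (by positivity)
  linarith

lemma growthFactor_succ (d b : ℕ) :
    growthFactor d (b + 1) + growthFactor d b / 2 ≤ growthFactor (d + 1) b := by
  have h := growthFactor_le d b
  have h1 : ((d + (b + 1)).factorial : ℝ) = (d + b + 1) * (d + b).factorial := by
    rw [← add_assoc, Nat.factorial_succ]
    push_cast
    ring
  have h2 : ((d + 1 + b).factorial : ℝ) = (d + b + 1) * (d + b).factorial := by
    rw [add_right_comm, Nat.factorial_succ]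
    push_cast
    ring
  have hpos : (0 : ℝ) < d + b + 1 := by positivity
  have e1 : growthFactor d (b + 1) = (2 * d + b + 1) * (d + b).factorial := by
    rw [growthFactor, h1]
    push_cast
    rw [← add_assoc]
    field_simp
    ring
  have e2 : growthFactor (d + 1) b = (2 * d + b + 2) * (d + b).factorial := by
    rw [growthFactor, h2]
    push_cast
    rw [add_right_comm (d : ℝ) 1]
    field_simp
    ring
  rw [e1, e2]
  linarith

variable (L : ℝ) (S : ℕ)

/-- The weight of a direction of differentiation. -/
noncomputable def dirWeight (n : ℕ) (i : Fin m) : ℝ := L * (basePrime (n := n) (Sum.inl i)) ^ S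

/-- The weight of a derivative. -/
noncomputable def weight (μ : Mon m n) : ℝ := L ^ deg μ * (label μ : ℝ) ^ S

/-- The weight of a word. -/
noncomputable def wordWeight (n : ℕ) (l : List (Fin m)) : ℝ := (l.map (dirWeight L S n)).prod

variable {L S}

lemma weight_shift (i : Fin m) (μ : Mon m n) :
    weight L S (shift i μ) = dirWeight L S n i * weight L S μ := by
  simp only [weight, dirWeight, deg_shift, label_shift]
  push_cast
  ring

lemma weight_shiftWord (l : List (Fin m)) (μ : Mon m n) :
    weight L S (shiftWord l μ) = wordWeight L S n l * weight L S μ := by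
  induction l with
  | nil => simp [shiftWord_nil, wordWeight]
  | cons i l ih =>
    rw [shiftWord_cons, weight_shift, ih]
    simp [wordWeight, mul_assoc]

lemma le_dirWeight (hL : 0 ≤ L) (i : Fin m) : L ≤ dirWeight L S n i := by
  refine le_mul_of_one_le_right hL (one_le_pow₀ ?_)
  exact_mod_cast (prime_basePrime (Sum.inl i : Fin m ⊕ Fin n)).one_le

lemma pow_le_wordWeight (hL : 0 ≤ L) (l : List (Fin m)) : L ^ l.length ≤ wordWeight L S n l := by
  induction l with
  | nil => simp [wordWeight]
  | cons i l ih =>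
    rw [List.length_cons, pow_succ', wordWeight, List.map_cons, List.prod_cons]
    exact mul_le_mul (le_dirWeight hL i) ih (pow_nonneg hL _) (hL.trans (le_dirWeight hL i))

lemma weight_pos (hL : 0 < L) (μ : Mon m n) : 0 < weight L S μ := by
  have := label_pos μ
  unfold weight
  positivity

lemma one_le_weight (hL : 1 ≤ L) (μ : Mon m n) : 1 ≤ weight L S μ := by
  refine one_le_mul_of_one_le_of_one_le (one_le_pow₀ hL) (one_le_pow₀ ?_)
  exact_mod_cast label_pos μ

lemma abs_rowEval_rowWord_single_le (hL : 0 ≤ L) {x : Fin m → ℝ} {c : Mon m n → ℝ} {M : ℝ}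
    {d : ℕ} (hM : ∀ ν, deg ν ≤ d → |c ν| ≤ M * (weight L S ν * (deg ν).factorial))
    (hM0 : 0 ≤ M) (l : List (Fin m)) :
    ∀ (a : MvPolynomial (Fin m) ℝ) (μ : Mon m n) (A : ℝ), 0 ≤ A →
      (∀ w, |MvPolynomial.eval x (polyWord w a)| ≤
        A * (wordWeight L S n w * (1 / 2) ^ w.length)) →
      deg μ + l.length ≤ d →
      |rowEval x c (rowWord l (Finsupp.single μ a))| ≤
        A * M * weight L S μ * wordWeight L S n l * growthFactor l.length (deg μ) := by
  induction l using List.reverseRecOn with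
  | nil =>
    intro a μ A hA ha hd
    have h0 := ha []
    simp only [polyWord, wordWeight, List.foldr_nil, List.map_nil, List.prod_nil, List.length_nil,
      pow_zero, mul_one] at h0
    simp only [rowWord_nil, rowEval_single, abs_mul, wordWeight, List.map_nil, List.prod_nil,
      List.length_nil, growthFactor_zero]
    calc _ ≤ A * (M * (weight L S μ * (deg μ).factorial)) :=
          mul_le_mul h0 (hM μ (by simpa using hd)) (abs_nonneg _) hA
      _ = _ := by ring
  | append_singleton l i ih =>
    intro a μ A hA ha hd
    rw [List.length_append, List.length_singleton] at hd ⊢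
    have hdir : 0 ≤ dirWeight L S n i := hL.trans (le_dirWeight hL i)
    have hword : 0 ≤ wordWeight L S n l := (pow_nonneg hL _).trans (pow_le_wordWeight hL l)
    have hwt : 0 ≤ weight L S μ := by unfold weight; positivity
    have hsnoc : ∀ w : List (Fin m), wordWeight L S n (w ++ [i]) =
        wordWeight L S n w * dirWeight L S n i := by
      intro w
      simp [wordWeight]
    have h1 := ih (MvPolynomial.pderiv i a) μ (A * dirWeight L S n i / 2) (by positivity)
      (fun w => by
        have := ha (w ++ [i])
        rw [polyWord_append_singleton, hsnoc, List.length_append, List.length_singleton] at this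
        refine this.trans_eq ?_
        rw [pow_succ]
        ring) (by omega)
    have h2 := ih a (shift i μ) A hA ha (by rw [deg_shift]; omega)
    rw [deg_shift, weight_shift] at h2
    rw [rowWord_append, rowWord_cons, rowWord_nil, rowD_single, map_add, map_add, hsnoc]
    refine (abs_add_le _ _).trans ((add_le_add h1 h2).trans ?_)
    have h3 := mul_le_mul_of_nonneg_left (growthFactor_succ l.length (deg μ))
      (show 0 ≤ A * M * weight L S μ * (wordWeight L S n l * dirWeight L S n i) by positivity)
    refine le_trans (le_of_eq ?_) h3
    ring

lemma exists_weights (T : Finset (Mon m n × Mon m n)) (hT : ∀ t ∈ T, key t.1 < key t.2) {ε : ℝ}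
    (hε : 0 < ε) :
    ∃ S, ∀ᶠ L : ℝ in atTop, ∀ t ∈ T, weight L S t.1 ≤ ε * weight L S t.2 := by
  have hS : ∀ᶠ S : ℕ in atTop, ∀ t ∈ T, label t.1 < label t.2 →
      (label t.1 : ℝ) ^ S ≤ ε * (label t.2 : ℝ) ^ S := by
    refine (Finset.eventually_all T).2 fun t _ => ?_
    by_cases h : label t.1 < label t.2
    · have hpos : (0 : ℝ) < label t.2 := by exact_mod_cast label_pos t.2
      have hlt : (label t.1 : ℝ) / label t.2 < 1 := (div_lt_one hpos).2 (by exact_mod_cast h)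
      have := (tendsto_pow_atTop_nhds_zero_of_lt_one (by positivity) hlt).eventually
        (gt_mem_nhds hε)
      filter_upwards [this] with S hS _
      rw [div_pow, div_lt_iff₀ (pow_pos hpos _)] at hS
      exact hS.le
    · exact Eventually.of_forall fun _ h' => absurd h' h
  obtain ⟨S, hS⟩ := hS.exists
  refine ⟨S, (Finset.eventually_all T).2 fun t ht => ?_⟩
  rcases key_lt_iff.1 (hT t ht) with h | ⟨hd, hl⟩
  · filter_upwards [eventually_ge_atTop 1, eventually_ge_atTop ((label t.1 : ℝ) ^ S / ε)]
      with L hL1 hL2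
    rw [div_le_iff₀ hε] at hL2
    have hone : (1 : ℝ) ≤ (label t.2 : ℝ) ^ S := one_le_pow₀ (by exact_mod_cast label_pos t.2)
    calc weight L S t.1 ≤ L ^ deg t.1 * (L * ε) :=
          mul_le_mul_of_nonneg_left hL2 (by positivity)
      _ = ε * (L ^ (deg t.1 + 1) * 1) := by ring
      _ ≤ ε * weight L S t.2 := by
        refine mul_le_mul_of_nonneg_left ?_ hε.le
        exact mul_le_mul (pow_le_pow_right₀ hL1 h) hone zero_le_one (by positivity)
  · filter_upwards [eventually_ge_atTop 0] with L hL
    rw [weight, weight, hd, mul_left_comm]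
    exact mul_le_mul_of_nonneg_left (hS t ht hl) (by positivity)

lemma rowWord_single_C (l : List (Fin m)) (μ : Mon m n) (r : ℝ) :
    rowWord l (Finsupp.single μ (MvPolynomial.C r)) =
      Finsupp.single (shiftWord l μ) (MvPolynomial.C r) := by
  induction l with
  | nil => simp [shiftWord_nil]
  | cons i l ih => simp [ih, rowD_single, shiftWord_cons]

/-- One reduction step: a relation with lead `β` improves the bound at `shiftWord l β`. -/
lemma abs_le_of_relation (hL : 2 ≤ L) {x : Fin m → ℝ} {c : Mon m n → ℝ} {M : ℝ} {d : ℕ}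
    (hM : ∀ ν, deg ν ≤ d → |c ν| ≤ M * (weight L S ν * (deg ν).factorial)) (hM0 : 0 ≤ M)
    {g : Row m n} {β : Mon m n} (hg : IsLead g β) {l : List (Fin m)}
    (hrel : rowEval x c (rowWord l g) = 0) (hd : deg β + l.length ≤ d) {C ε : ℝ} (hC0 : 0 ≤ C)
    (hC : ∀ μ w, |MvPolynomial.eval x (polyWord w (g μ))| ≤ C)
    (hε : ∀ μ ∈ g.support, μ ≠ β → weight L S μ ≤ ε * weight L S β) (hLε : 2 / L ≤ ε)
    (hsmall : g.support.card * (2 * (C * ε)) ≤ |MvPolynomial.eval x (g β)| / 2)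
    (hne : MvPolynomial.eval x (g β) ≠ 0) :
    |c (shiftWord l β)| ≤
      M / 2 * (weight L S (shiftWord l β) * (deg (shiftWord l β)).factorial) := by
  have hL0 : 0 < L := by linarith
  set r := MvPolynomial.eval x (g β) with hr
  set B : ℝ := M * weight L S β * wordWeight L S n l * (l.length + deg β).factorial with hB
  have hword : 0 ≤ wordWeight L S n l := (pow_nonneg hL0.le _).trans (pow_le_wordWeight hL0.le l)
  have hwt : ∀ μ : Mon m n, 0 ≤ weight L S μ := fun μ => (weight_pos hL0 μ).le
  have hε0 : 0 ≤ ε := le_trans (by positivity) hLε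
  have hB0 : 0 ≤ B := by have := hwt β; positivity
  have hhalf : ∀ w : List (Fin m), (L / 2) ^ w.length ≤
      wordWeight L S n w * (1 / 2) ^ w.length := by
    intro w
    rw [div_eq_mul_one_div, mul_pow]
    exact mul_le_mul_of_nonneg_right (pow_le_wordWeight hL0.le w) (by positivity)
  let e : Mon m n → MvPolynomial (Fin m) ℝ := fun μ =>
    if μ = β then g β - MvPolynomial.C r else g μ
  have hterm : ∀ μ ∈ g.support,
      |rowEval x c (rowWord l (Finsupp.single μ (e μ)))| ≤ 2 * (C * ε) * B := by
    intro μ hμ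
    rcases eq_or_ne μ β with rfl | hμβ
    · have h := abs_rowEval_rowWord_single_le hL0.le hM hM0 l (e μ) μ (C * (2 / L))
        (by positivity) (fun w => by
          simp only [e, if_true]
          cases w with
          | nil =>
            have hz : MvPolynomial.eval x (polyWord [] (g μ - MvPolynomial.C r)) = 0 := by
              rw [polyWord, List.foldr_nil, map_sub, MvPolynomial.eval_C]
              exact sub_self _
            rw [hz, abs_zero]
            simp only [wordWeight, List.map_nil, List.prod_nil, List.length_nil]
            positivity
          | cons i w =>
            rw [polyWord_cons_sub_C]
            refine (hC μ _).trans ?_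
            rw [mul_assoc]
            refine le_mul_of_one_le_right hC0 ?_
            have h1 : (L / 2) ^ 1 ≤ (L / 2) ^ (i :: w).length :=
              pow_le_pow_right₀ (by linarith) (by simp)
            have h2 := mul_le_mul_of_nonneg_left (h1.trans (hhalf (i :: w)))
              (show 0 ≤ 2 / L by positivity)
            refine le_trans (le_of_eq ?_) h2
            field_simp) hd
      calc _ ≤ _ := h
        _ ≤ C * ε * M * weight L S μ * wordWeight L S n l * (2 * (l.length + deg μ).factorial) := by
          have := hwt μ
          refine mul_le_mul ?_ (growthFactor_le _ _) ?_ (by positivity)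
          · gcongr
          · unfold growthFactor; positivity
        _ = _ := by rw [hB]; ring
    · have hdeg : deg μ ≤ deg β := deg_le_of_key_le (hg.2 μ (Finsupp.mem_support_iff.1 hμ))
      have h := abs_rowEval_rowWord_single_le hL0.le hM hM0 l (e μ) μ C hC0 (fun w => by
          simp only [e, if_neg hμβ]
          refine (hC μ w).trans (le_mul_of_one_le_right hC0 (le_trans ?_ (hhalf w)))
          exact one_le_pow₀ (by linarith)) (by omega)
      calc _ ≤ _ := h
        _ ≤ C * M * (ε * weight L S β) * wordWeight L S n l *
            (2 * (l.length + deg β).factorial) := by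
          have := hwt β
          refine mul_le_mul ?_ ((growthFactor_le _ _).trans ?_) ?_ (by positivity)
          · have := hε μ hμ hμβ
            gcongr
          · gcongr
          · unfold growthFactor; positivity
        _ = _ := by rw [hB]; ring
  have hsplit : g = Finsupp.single β (MvPolynomial.C r) +
      ∑ μ ∈ g.support, Finsupp.single μ (e μ) := by
    have hβ : β ∈ g.support := Finsupp.mem_support_iff.2 hg.1
    conv_lhs => rw [← Finsupp.sum_single g, Finsupp.sum]
    rw [← Finset.add_sum_erase _ _ hβ, ← Finset.add_sum_erase _ _ hβ, ← add_assoc]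
    congr 1
    · simp [e]
    · refine Finset.sum_congr rfl fun μ hμ => ?_
      simp only [e, if_neg (Finset.ne_of_mem_erase hμ)]
  have hmain : r * c (shiftWord l β) =
      -∑ μ ∈ g.support, rowEval x c (rowWord l (Finsupp.single μ (e μ))) := by
    rw [hsplit, map_add, map_add, rowWord_single_C, rowEval_single, MvPolynomial.eval_C, map_sum,
      map_sum] at hrel
    linarith
  have hbound : |r| * |c (shiftWord l β)| ≤ |r| * (1 / 2 * B) := by
    rw [← abs_mul, hmain, abs_neg]
    calc _ ≤ ∑ μ ∈ g.support, |rowEval x c (rowWord l (Finsupp.single μ (e μ)))| :=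
          Finset.abs_sum_le_sum_abs _ _
      _ ≤ ∑ μ ∈ g.support, 2 * (C * ε) * B := Finset.sum_le_sum hterm
      _ = g.support.card * (2 * (C * ε)) * B := by
        rw [Finset.sum_const, nsmul_eq_mul]; ring
      _ ≤ |r| / 2 * B := mul_le_mul_of_nonneg_right hsmall hB0
      _ = _ := by ring
  refine (le_of_mul_le_mul_left hbound (abs_pos.2 hne)).trans_eq ?_
  rw [weight_shiftWord, deg_shiftWord, hB, add_comm l.length]
  ring

lemma exists_bound_polyWord_rows (x : Fin m → ℝ) (G : Finset (Row m n × Mon m n)) :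
    ∃ C : ℝ, 0 ≤ C ∧ ∀ g ∈ G, ∀ μ w, |MvPolynomial.eval x (polyWord w (g.1 μ))| ≤ C := by
  choose b hb0 hb using exists_bound_polyWord x
  refine ⟨∑ g ∈ G, ∑ μ ∈ g.1.support, b (g.1 μ),
    Finset.sum_nonneg fun _ _ => Finset.sum_nonneg fun _ _ => hb0 _, fun g hg μ w => ?_⟩
  have h1 : ∑ μ ∈ g.1.support, b (g.1 μ) ≤ ∑ g ∈ G, ∑ μ ∈ g.1.support, b (g.1 μ) :=
    Finset.single_le_sum (f := fun g : Row m n × Mon m n => ∑ μ ∈ g.1.support, b (g.1 μ))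
      (fun _ _ => Finset.sum_nonneg fun _ _ => hb0 _) hg
  refine le_trans ?_ h1
  by_cases hμ : μ ∈ g.1.support
  · exact (hb _ w).trans (Finset.single_le_sum (f := fun μ => b (g.1 μ)) (fun _ _ => hb0 _) hμ)
  · have hz : polyWord w (0 : MvPolynomial (Fin m) ℝ) = 0 := by
      induction w with
      | nil => rfl
      | cons i w ih =>
        simp only [polyWord, List.foldr_cons] at ih ⊢
        rw [ih, map_zero]
    rw [Finsupp.notMem_support_iff.1 hμ, hz, map_zero, abs_zero]
    exact Finset.sum_nonneg fun _ _ => hb0 _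

lemma exists_weight_le (hL : 0 ≤ L) :
    ∃ C Λ : ℝ, 0 ≤ C ∧ 0 ≤ Λ ∧ ∀ μ : Mon m n, weight L S μ ≤ C * Λ ^ deg μ := by
  set Q : ℝ := ∑ i : Fin m, (basePrime (n := n) (Sum.inl i) : ℝ) with hQ
  set P : ℝ := ∑ j : Fin n, (basePrime (m := m) (Sum.inr j) : ℝ) with hP
  have hQ0 : 0 ≤ Q := Finset.sum_nonneg fun _ _ => Nat.cast_nonneg _
  have hP0 : 0 ≤ P := Finset.sum_nonneg fun _ _ => Nat.cast_nonneg _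
  refine ⟨P ^ S, L * Q ^ S, by positivity, by positivity, fun μ => ?_⟩
  have hlabel : (label μ : ℝ) ≤ Q ^ deg μ * P := by
    rw [label]
    push_cast
    refine mul_le_mul ?_ ?_ (by positivity) (by positivity)
    · rw [deg, ← Finset.prod_pow_eq_pow_sum]
      refine Finset.prod_le_prod (fun _ _ => by positivity) fun i _ => ?_
      refine pow_le_pow_left₀ (by positivity) ?_ _
      exact Finset.single_le_sum (f := fun i : Fin m => (basePrime (n := n) (Sum.inl i) : ℝ))
        (fun _ _ => Nat.cast_nonneg _) (Finset.mem_univ i)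
    · exact Finset.single_le_sum (f := fun j : Fin n => (basePrime (m := m) (Sum.inr j) : ℝ))
        (fun _ _ => Nat.cast_nonneg _) (Finset.mem_univ μ.2)
  calc weight L S μ ≤ L ^ deg μ * (Q ^ deg μ * P) ^ S :=
        mul_le_mul_of_nonneg_left (pow_le_pow_left₀ (by positivity) hlabel S) (by positivity)
    _ = _ := by
      rw [mul_pow, mul_pow, ← pow_mul, ← pow_mul, mul_comm (deg μ) S]
      ring

lemma exists_small (C K : ℝ) (hC : 0 ≤ C) (hK : 0 ≤ K) {ρ : ℝ} (hρ : 0 < ρ) :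
    ∃ ε : ℝ, 0 < ε ∧ K * (2 * (C * ε)) ≤ ρ / 2 := by
  have h : 0 < 4 * (K * C + 1) := by positivity
  refine ⟨ρ / (4 * (K * C + 1)), by positivity, ?_⟩
  have e : K * (2 * (C * (ρ / (4 * (K * C + 1))))) = 2 * (K * C) * ρ / (4 * (K * C + 1)) := by ring
  rw [e, div_le_iff₀ h]
  nlinarith

/-- Values of derivatives determined by boundedly many free parameters through linear relations
grow like the Taylor coefficients of an analytic function. -/
lemma exists_growth_bound {x : Fin m → ℝ} {c : Mon m n → ℝ}
    (G : Finset (Row m n × Mon m n)) (hlead : ∀ g ∈ G, IsLead g.1 g.2)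
    (hne : ∀ g ∈ G, MvPolynomial.eval x (g.1 g.2) ≠ 0)
    (hrel : ∀ g ∈ G, ∀ l, rowEval x c (rowWord l g.1) = 0)
    (hc : ∀ μ, |c μ| ≤ 1 ∨ ∃ g ∈ G, ∃ l, μ = shiftWord l g.2) :
    ∃ C Λ : ℝ, 0 ≤ C ∧ 0 ≤ Λ ∧ ∀ μ, |c μ| ≤ C * Λ ^ deg μ * (deg μ).factorial := by
  classical
  obtain ⟨C, hC0, hC⟩ := exists_bound_polyWord_rows x G
  obtain ⟨ρ, hρ0, hρ⟩ : ∃ ρ : ℝ, 0 < ρ ∧ ∀ g ∈ G, ρ ≤ |MvPolynomial.eval x (g.1 g.2)| := by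
    have : ∀ᶠ ρ : ℝ in 𝓝[>] 0, ∀ g ∈ G, ρ ≤ |MvPolynomial.eval x (g.1 g.2)| := by
      refine (Finset.eventually_all G).2 fun g hg => ?_
      exact (eventually_le_nhds (abs_pos.2 (hne g hg))).filter_mono nhdsWithin_le_nhds
    obtain ⟨ρ, h1, h2⟩ := (this.and self_mem_nhdsWithin).exists
    exact ⟨ρ, h2, h1⟩
  set K : ℝ := ∑ g ∈ G, (g.1.support.card : ℝ)
  have hK0 : 0 ≤ K := Finset.sum_nonneg fun _ _ => Nat.cast_nonneg _
  obtain ⟨ε, hε0, hKε⟩ := exists_small C K hC0 hK0 hρ0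
  let T : Finset (Mon m n × Mon m n) :=
    G.biUnion fun g => (g.1.support.erase g.2).image fun μ => (μ, g.2)
  obtain ⟨S, hS⟩ := exists_weights T (fun t ht => by
    simp only [T, Finset.mem_biUnion, Finset.mem_image, Finset.mem_erase] at ht
    obtain ⟨g, hg, μ, ⟨hμ, hμs⟩, rfl⟩ := ht
    exact lt_of_le_of_ne ((hlead g hg).2 μ (Finsupp.mem_support_iff.1 hμs))
      fun h => hμ (key_injective h)) hε0
  obtain ⟨L, hLT, hL2, hLε⟩ := (hS.and ((eventually_ge_atTop 2).and
    (eventually_ge_atTop (2 / ε)))).exists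
  have hL0 : 0 < L := by linarith
  have hbound : ∀ d, ∀ ν, deg ν ≤ d → |c ν| ≤ weight L S ν * (deg ν).factorial := by
    intro d ν₀ hν₀
    let D : Finset (Mon m n) :=
      (Finset.Iic (fun _ => d : Fin m → ℕ) ×ˢ Finset.univ).filter fun ν => deg ν ≤ d
    have hD : ∀ ν, ν ∈ D ↔ deg ν ≤ d := by
      intro ν
      simp only [D, Finset.mem_filter, Finset.mem_product, Finset.mem_Iic, Finset.mem_univ,
        and_true, and_iff_right_iff_imp]
      intro h i
      exact (Finset.single_le_sum (f := ν.1) (fun _ _ => Nat.zero_le _) (Finset.mem_univ i)).trans h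
    have hBpos : ∀ ν : Mon m n, 0 < weight L S ν * (deg ν).factorial := fun ν =>
      mul_pos (weight_pos hL0 ν) (by positivity)
    obtain ⟨ν, hν, hmax⟩ := Finset.exists_max_image D
      (fun ν => |c ν| / (weight L S ν * (deg ν).factorial)) ⟨ν₀, (hD _).2 hν₀⟩
    set M := |c ν| / (weight L S ν * (deg ν).factorial) with hMdef
    have hM0 : 0 ≤ M := div_nonneg (abs_nonneg _) (hBpos ν).le
    have hM : ∀ ν, deg ν ≤ d → |c ν| ≤ M * (weight L S ν * (deg ν).factorial) := fun ν' h =>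
      (div_le_iff₀ (hBpos ν')).1 (hmax ν' ((hD _).2 h))
    have hM1 : M ≤ 1 := by
      rcases hc ν with h | ⟨g, hg, l, hl⟩
      · refine div_le_one_of_le₀ (h.trans ?_) (hBpos ν).le
        refine one_le_mul_of_one_le_of_one_le (one_le_weight (by linarith) ν) ?_
        exact_mod_cast Nat.factorial_pos _
      · have hcard : (g.1.support.card : ℝ) ≤ K :=
          Finset.single_le_sum (f := fun g : Row m n × Mon m n => (g.1.support.card : ℝ))
            (fun _ _ => Nat.cast_nonneg _) hg
        have hdeg : deg g.2 + l.length ≤ d := by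
          rw [← deg_shiftWord, ← hl]
          exact (hD _).1 hν
        have h := abs_le_of_relation hL2 hM hM0 (hlead g hg) (hrel g hg l) hdeg hC0 (hC g hg)
          (ε := ε) (fun μ hμ hne => hLT (μ, g.2) (by
            simp only [T, Finset.mem_biUnion, Finset.mem_image, Finset.mem_erase]
            exact ⟨g, hg, μ, ⟨hne, hμ⟩, rfl⟩))
          (by rw [div_le_iff₀ hL0]; rw [div_le_iff₀ hε0] at hLε; linarith)
          ((mul_le_mul_of_nonneg_right hcard (by positivity)).trans
            (hKε.trans (by have := hρ g hg; linarith))) (hne g hg)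
        rw [← hl, ← div_le_iff₀ (hBpos ν), ← hMdef] at h
        linarith
    refine (hM ν₀ hν₀).trans ?_
    exact mul_le_of_le_one_left (hBpos ν₀).le hM1
  obtain ⟨B, Λ, hB, hΛ, hw⟩ := exists_weight_le (m := m) (n := n) (S := S) hL0.le
  exact ⟨B, Λ, hB, hΛ, fun μ => (hbound _ μ le_rfl).trans
    (mul_le_mul_of_nonneg_right (hw μ) (by positivity))⟩

end Growth

section Fibre

variable {m n : ℕ}

lemma exists_eval_ne_zero {w : MvPolynomial (Fin m) ℝ} (hw : w ≠ 0) {U : Set (Fin m → ℝ)}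
    (hU : IsOpen U) (hne : U.Nonempty) : ∃ x ∈ U, MvPolynomial.eval x w ≠ 0 := by
  by_contra! h
  obtain ⟨x, hx⟩ := hne
  obtain ⟨ε, hε, hball⟩ := Metric.isOpen_iff.1 hU x hx
  refine hw (MvPolynomial.funext_set (fun i => Metric.ball (x i) ε) (fun i => ?_) fun y hy => ?_)
  · rw [Real.ball_eq_Ioo]
    exact Set.Ioo_infinite (by linarith)
  · rw [map_zero]
    refine h y (hball ?_)
    rwa [ball_pi x hε]

/-- Evaluation of the coefficients of a row at a point. -/
noncomputable def evalRow (x : Fin m → ℝ) : Row m n →ₗ[ℝ] (Mon m n →₀ ℝ) :=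
  Finsupp.mapRange.linearMap (MvPolynomial.aeval x).toLinearMap

@[simp] lemma evalRow_apply (x : Fin m → ℝ) (v : Row m n) (μ : Mon m n) :
    evalRow x v μ = MvPolynomial.eval x (v μ) := by
  simp [evalRow]

lemma evalRow_smul (x : Fin m → ℝ) (a : MvPolynomial (Fin m) ℝ) (v : Row m n) :
    evalRow x (a • v) = MvPolynomial.eval x a • evalRow x v := by
  ext μ
  simp

lemma rowEval_eq_of_linearMap (x : Fin m → ℝ) (T : (Mon m n →₀ ℝ) →ₗ[ℝ] ℝ) (v : Row m n) :
    rowEval x (fun μ => T (Finsupp.single μ 1)) v = T (evalRow x v) := by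
  induction v using Finsupp.induction_linear with
  | zero => simp
  | add v w hv hw => rw [map_add, map_add, map_add, hv, hw]
  | single μ a =>
    have : evalRow x (Finsupp.single μ a) =
        MvPolynomial.eval x a • (Finsupp.single μ 1 : Mon m n →₀ ℝ) := by
      simp [evalRow]
    rw [rowEval_single, this, map_smul, smul_eq_mul]

lemma IsLead.evalRow {v : Row m n} {μ : Mon m n} (h : IsLead v μ) {x : Fin m → ℝ}
    (hx : MvPolynomial.eval x (v μ) ≠ 0) : IsLead (evalRow x v) μ :=
  ⟨by simpa using hx, fun ν hν => h.2 ν fun h0 => hν (by simp [h0])⟩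

/-- Leads of a specialized module are leads of the module itself, as long as the leading
coefficients of a suitable finite family do not vanish at the point. -/
lemma exists_isLead_evalRow {N : Submodule (MvPolynomial (Fin m) ℝ) (Row m n)}
    (hN : ∀ i, ∀ v ∈ N, rowD i v ∈ N) {G : Finset (Row m n × Mon m n)}
    (hG : ∀ g ∈ G, g.1 ∈ N ∧ IsLead g.1 g.2)
    (hlead : ∀ v ∈ N, ∀ μ, IsLead v μ → ∃ g ∈ G, ∃ l, μ = shiftWord l g.2)
    {x : Fin m → ℝ} (hx : ∀ g ∈ G, MvPolynomial.eval x (g.1 g.2) ≠ 0) :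
    ∀ v ∈ N, evalRow x v ≠ 0 →
      ∃ μ, IsLead (evalRow x v) μ ∧ ∃ g ∈ G, ∃ l, μ = shiftWord l g.2 := by
  suffices H : ∀ μ, ∀ v ∈ N, IsLead v μ → evalRow x v ≠ 0 →
      ∃ μ, IsLead (evalRow x v) μ ∧ ∃ g ∈ G, ∃ l, μ = shiftWord l g.2 by
    intro v hv hne
    obtain ⟨μ, hμ⟩ := exists_isLead (v := v) (by rintro rfl; exact hne (map_zero _))
    exact H μ v hv hμ hne
  intro μ
  induction hk : key μ using WellFoundedLT.induction generalizing μ with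
  | ind k ih =>
    subst hk
    intro v hv hμ hne
    obtain ⟨g, hg, l, hl⟩ := hlead v hv μ hμ
    by_cases hzero : MvPolynomial.eval x (v μ) = 0
    · set g' := rowWord l g.1 with hg'
      have hg'N : g' ∈ N := rowWord_mem hN l (hG g hg).1
      have hg'lead : IsLead g' μ := by rw [hl]; exact ((hG g hg).2.rowWord l).1
      have hg'val : g' μ = g.1 g.2 := by rw [hl]; exact ((hG g hg).2.rowWord l).2
      set v' := g.1 g.2 • v - v μ • g' with hv'
      have hev : evalRow x v' = MvPolynomial.eval x (g.1 g.2) • evalRow x v := by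
        rw [hv', map_sub, evalRow_smul, evalRow_smul, hzero, zero_smul, sub_zero]
      have hv'N : v' ∈ N := N.sub_mem (N.smul_mem _ hv) (N.smul_mem _ hg'N)
      have hne' : evalRow x v' ≠ 0 := by
        rw [hev]
        exact smul_ne_zero (hx g hg) hne
      obtain ⟨ρ, hρ⟩ := exists_isLead (v := v') (by rintro h; exact hne' (by rw [h, map_zero]))
      have hρμ : key ρ < key μ := by
        refine lt_of_le_of_ne ?_ fun h => hρ.1 ?_
        · by_contra hlt
          refine hρ.1 ?_
          have h1 : v ρ = 0 := by
            by_contra h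
            exact hlt (hμ.2 ρ h)
          have h2 : g' ρ = 0 := by
            by_contra h
            exact hlt (hg'lead.2 ρ h)
          simp [hv', h1, h2]
        · rw [key_injective h]
          simp [hv', hg'val, mul_comm]
      obtain ⟨σ, hσ, hσG⟩ := ih _ hρμ ρ rfl v' hv'N hρ hne'
      refine ⟨σ, ⟨fun h => hσ.1 (by rw [hev, Finsupp.smul_apply, h, smul_zero]), fun ν hν => ?_⟩,
        hσG⟩
      refine hσ.2 ν ?_
      rw [hev, Finsupp.smul_apply]
      exact smul_ne_zero (hx g hg) hν
    · exact ⟨μ, hμ.evalRow hzero, g, hg, l, hl⟩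

/-- A row outside a saturated module of rows closed under differentiation is separated from it
by the Taylor coefficients of a tuple of analytic functions. -/
lemma exists_separating {N : Submodule (MvPolynomial (Fin m) ℝ) (Row m n)}
    (hN : ∀ i, ∀ v ∈ N, rowD i v ∈ N)
    (hsat : ∀ (w : MvPolynomial (Fin m) ℝ) (v : Row m n), w ≠ 0 → w • v ∈ N → v ∈ N)
    {r : Row m n} (hr : r ∉ N) {U : Set (Fin m → ℝ)} (hU : IsOpen U) (hUne : U.Nonempty) :
    ∃ x ∈ U, ∃ c : Mon m n → ℝ, (∀ v ∈ N, rowEval x c v = 0) ∧ rowEval x c r ≠ 0 ∧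
      ∃ C Λ : ℝ, 0 ≤ C ∧ 0 ≤ Λ ∧ ∀ μ, |c μ| ≤ C * Λ ^ deg μ * (deg μ).factorial := by
  classical
  obtain ⟨G, hG, hlead⟩ := exists_finset_leads N
  let Std : Set (Mon m n) := {μ | ¬ ∃ g ∈ G, ∃ l, μ = shiftWord l g.2}
  have hgen : saturation (N ⊔ Finsupp.supported _ (MvPolynomial (Fin m) ℝ) Std) = ⊤ := by
    refine eq_top_of_isLead _ fun μ => ?_
    by_cases hμ : μ ∈ Std
    · exact Or.inl (le_saturation _ (le_sup_right (a := N)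
        (Finsupp.single_mem_supported _ _ hμ)))
    · obtain ⟨g, hg, l, hl⟩ := not_not.1 hμ
      have h := (hG g hg).2.rowWord l
      rw [← hl] at h
      exact Or.inr ⟨rowWord l g.1, le_saturation _ (le_sup_left (a := N)
        (rowWord_mem hN l (hG g hg).1)), h.1, fun y => mem_saturation_of_smul_mem h.1.1⟩
  obtain ⟨w, hw, hwr⟩ := mem_saturation.1 (hgen ▸ Submodule.mem_top : r ∈ saturation _)
  obtain ⟨v, hv, a, ha, hva⟩ := Submodule.mem_sup.1 hwr
  have ha0 : a ≠ 0 := by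
    rintro rfl
    rw [add_zero] at hva
    exact hr (hsat w r hw (hva ▸ hv))
  obtain ⟨s, hs⟩ := Finsupp.support_nonempty_iff.2 ha0
  have hsne := Finsupp.mem_support_iff.1 hs
  obtain ⟨x, hxU, hx⟩ := exists_eval_ne_zero
    (mul_ne_zero hsne (Finset.prod_ne_zero_iff.2 fun g hg => (hG g hg).2.1)) hU hUne
  rw [map_mul, map_prod, mul_ne_zero_iff, Finset.prod_ne_zero_iff] at hx
  let W : Submodule ℝ (Mon m n →₀ ℝ) := (N.restrictScalars ℝ).map (evalRow x)
  have hcompl : IsCompl (Finsupp.supported ℝ ℝ Std) W := by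
    constructor
    · rw [disjoint_comm, Submodule.disjoint_def]
      rintro y ⟨v, hv, rfl⟩ hy
      by_contra hne
      obtain ⟨μ, hμ, hμG⟩ := exists_isLead_evalRow hN hG hlead hx.2 v hv hne
      exact (Finsupp.mem_supported _ _).1 hy (Finsupp.mem_support_iff.2 hμ.1) hμG
    · rw [codisjoint_iff]
      refine eq_top_of_isLead _ fun μ => ?_
      by_cases hμ : μ ∈ Std
      · exact Or.inl (Submodule.mem_sup_left (Finsupp.single_mem_supported _ _ hμ))
      · obtain ⟨g, hg, l, hl⟩ := not_not.1 hμ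
        have h := (hG g hg).2.rowWord l
        rw [← hl] at h
        have hlead' := h.1.evalRow (x := x) (by rw [h.2]; exact hx.2 g hg)
        exact Or.inr ⟨evalRow x (rowWord l g.1), Submodule.mem_sup_right
          ⟨_, rowWord_mem hN l (hG g hg).1, rfl⟩, hlead',
          fun y hy => (Submodule.smul_mem_iff _ hlead'.1).1 hy⟩
  let T : (Mon m n →₀ ℝ) →ₗ[ℝ] ℝ := Finsupp.lapply s ∘ₗ Submodule.projection _ _ hcompl
  have hTstd : ∀ y ∈ Finsupp.supported ℝ ℝ Std, T y = y s := fun y hy => by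
    simp only [T, LinearMap.comp_apply, Submodule.projection_apply_of_mem_left hcompl hy,
      Finsupp.lapply_apply]
  have hTN : ∀ v ∈ N, T (evalRow x v) = 0 := fun v hv => by
    have : evalRow x v ∈ W := ⟨v, hv, rfl⟩
    simp only [T, LinearMap.comp_apply, (Submodule.projection_apply_eq_zero_iff hcompl).2 this,
      map_zero]
  refine ⟨x, hxU, fun μ => T (Finsupp.single μ 1), fun v hv => ?_, fun h => ?_, ?_⟩
  · rw [rowEval_eq_of_linearMap, hTN v hv]
  · have h1 : rowEval x (fun μ => T (Finsupp.single μ 1)) (w • r) = 0 := by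
      rw [rowEval_smul, h, mul_zero]
    rw [← hva, rowEval_eq_of_linearMap, map_add, map_add, hTN v hv, zero_add, hTstd,
      evalRow_apply] at h1
    · exact hx.1 h1
    · refine (Finsupp.mem_supported _ _).2 fun μ hμ => ?_
      refine (Finsupp.mem_supported _ _).1 ha (Finsupp.mem_support_iff.2 fun h0 => ?_)
      exact Finsupp.mem_support_iff.1 hμ (by rw [evalRow_apply, h0, map_zero])
  · refine exists_growth_bound (x := x) G (fun g hg => (hG g hg).2) hx.2 (fun g hg l => ?_)
      fun μ => ?_
    · rw [rowEval_eq_of_linearMap, hTN _ (rowWord_mem hN l (hG g hg).1)]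
    · by_cases hμ : μ ∈ Std
      · left
        rw [hTstd _ (Finsupp.single_mem_supported _ _ hμ), Finsupp.single_apply]
        split_ifs <;> simp
      · exact Or.inr (not_not.1 hμ)

end Fibre

section Equivalence

variable {m n k : ℕ}

lemma eventually_eq_zero_of_smul_mem {p : Fin k → Fin n → PDO ℝ m} {q : Fin n → PDO ℝ m}
    {w : MvPolynomial (Fin m) ℝ} (hw : w ≠ 0) {h : Fin k → PDO ℝ m}
    (H : w • toRow q = ∑ i, opMul (h i) (toRow (p i))) {x₀ : Fin m → ℝ}
    {u : Fin n → (Fin m → ℝ) → ℝ} (hu : ∀ j, AnalyticAt ℝ (u j) x₀)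
    (hp : ∀ i, ∀ᶠ x in 𝓝 x₀, ∑ j, PDO.app (p i j) (u j) x = 0) :
    ∀ᶠ x in 𝓝 x₀, ∑ j, PDO.app (q j) (u j) x = 0 := by
  have han : ∀ᶠ x in 𝓝 x₀, ∀ j, AnalyticAt ℝ (u j) x :=
    eventually_all.2 fun j => (hu j).eventually_analyticAt
  have hmul : ∀ᶠ x in 𝓝 x₀, MvPolynomial.eval x w * rowApp (toRow q) u x = 0 := by
    filter_upwards [han, eventually_all.2 fun i => (hp i).eventually_nhds] with x hx hpx
    rw [rowApp, ← rowEval_smul, H, map_sum]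
    refine Finset.sum_eq_zero fun i _ => ?_
    have hz : rowApp (toRow (p i)) u =ᶠ[𝓝 x] 0 := by
      filter_upwards [hpx i] with y hy
      rw [rowApp_toRow, hy, Pi.zero_apply]
    rw [← rowApp, ← app_rowApp (h i) (toRow (p i)) hx, app_congr (h i) hz]
    exact app_zero_fun _ _
  obtain ⟨V, hV, hVo, hxV⟩ := eventually_nhds_iff.1 (han.and hmul)
  refine eventually_nhds_iff.2 ⟨V, fun x hx => ?_, hVo, hxV⟩
  rw [← rowApp_toRow]
  by_contra hne
  have hcont : ∀ᶠ y in 𝓝 x, rowApp (toRow q) u y ≠ 0 :=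
    (analyticAt_rowApp (toRow q) (hV x hx).1).continuousAt.eventually_ne hne
  obtain ⟨V', hV', hV'o, hxV'⟩ := eventually_nhds_iff.1 (hcont.and (hVo.mem_nhds hx))
  obtain ⟨y, hy, hwy⟩ := exists_eval_ne_zero hw hV'o ⟨x, hxV'⟩
  exact mul_ne_zero hwy (hV' y hy).1 (hV y (hV' y hy).2).2

lemma exists_smul_mem_rowModule {p : Fin k → Fin n → PDO ℝ m} {q : Fin n → PDO ℝ m}
    {U : Set (Fin m → ℝ)} (hU : IsOpen U) (hUne : U.Nonempty)
    (H : ∀ x₀ ∈ U, ∀ (u : Fin n → (Fin m → ℝ) → ℝ), (∀ j, AnalyticAt ℝ (u j) x₀) →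
      (∀ i, ∀ᶠ x in 𝓝 x₀, ∑ j, PDO.app (p i j) (u j) x = 0) →
      (∀ᶠ x in 𝓝 x₀, ∑ j, PDO.app (q j) (u j) x = 0)) :
    toRow q ∈ saturation (rowModule fun i => toRow (p i)) := by
  by_contra hq
  have hN : ∀ i, ∀ v ∈ saturation (rowModule fun i => toRow (p i)),
      rowD i v ∈ saturation (rowModule fun i => toRow (p i)) := fun i v hv =>
    rowD_mem_saturation (fun i v hv => rowD_mem_rowModule i hv) i hv
  obtain ⟨x₀, hx₀, c, hc, hcq, C, Λ, hC, hΛ, hbound⟩ := exists_separating hN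
    (fun w v hw hv => mem_saturation_of_smul_mem hw hv) hq hU hUne
  have hex : ∀ j : Fin n, ∃ u, AnalyticAt ℝ u x₀ ∧ ∀ α, iterPDeriv α u x₀ = c (α, j) := fun j =>
    exists_analyticAt_iterPDeriv_eq x₀ hC hΛ fun α => hbound (α, j)
  choose u hu huc using hex
  have hjet : jet u x₀ = c := funext fun μ => huc μ.2 μ.1
  have hsol : ∀ i, ∀ᶠ x in 𝓝 x₀, ∑ j, PDO.app (p i j) (u j) x = 0 := by
    intro i
    simp only [← rowApp_toRow]
    refine eventually_eq_zero_of_wordDeriv_eq_zero (analyticAt_rowApp _ hu) fun l => ?_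
    rw [(wordDeriv_rowApp (toRow (p i)) hu l).eq_of_nhds, rowApp, hjet]
    exact hc _ (rowWord_mem hN l (le_saturation _ (subset_rowModule _ i)))
  have hzero := (H x₀ hx₀ u hu hsol).self_of_nhds
  rw [← rowApp_toRow, rowApp, hjet] at hzero
  exact hcq hzero

end Equivalence

end WeylNull

/-- Nullstellensatz for linear PDE with polynomial coefficients over ℝ
(Theorem `mainthm` of the paper). -/
theorem weyl_nullstellensatz_real
    (m n k : ℕ) (hm : 0 < m) (hn : 0 < n) (hk : 0 < k)
    (U : Set (Fin m → ℝ)) (hUopen : IsOpen U) (hUne : U.Nonempty)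
    (p : Fin k → Fin n → PDO ℝ m) (q : Fin n → PDO ℝ m) :
    List.TFAE [
      -- (1): vanishing on all local analytic solutions at all points of ℝ^m
      (∀ (x₀ : Fin m → ℝ) (u : Fin n → (Fin m → ℝ) → ℝ),
        (∀ j, AnalyticAt ℝ (u j) x₀) →
        (∀ i, ∀ᶠ x in 𝓝 x₀, ∑ j, PDO.app (p i j) (u j) x = 0) →
        (∀ᶠ x in 𝓝 x₀, ∑ j, PDO.app (q j) (u j) x = 0)),
      -- (1'): vanishing on all local analytic solutions at points of U
      (∀ x₀ ∈ U, ∀ (u : Fin n → (Fin m → ℝ) → ℝ),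
        (∀ j, AnalyticAt ℝ (u j) x₀) →
        (∀ i, ∀ᶠ x in 𝓝 x₀, ∑ j, PDO.app (p i j) (u j) x = 0) →
        (∀ᶠ x in 𝓝 x₀, ∑ j, PDO.app (q j) (u j) x = 0)),
      -- (2): w·q lies in the module generated by the rows of p
      (∃ w : MvPolynomial (Fin m) ℝ, w ≠ 0 ∧ ∃ h : Fin k → PDO ℝ m,
        ∀ (j : Fin n) (g : MvPolynomial (Fin m) ℝ) (x : Fin m → ℝ),
          MvPolynomial.eval x w *
              PDO.app (q j) (fun y => MvPolynomial.eval y g) x =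
            ∑ i, PDO.app (h i)
              (PDO.app (p i j) (fun y => MvPolynomial.eval y g)) x)
    ] := by
  tfae_have 1 → 2 := fun h x₀ _ => h x₀
  tfae_have 2 → 3 := fun h => by
    obtain ⟨w, hw, hmem⟩ :=
      WeylNull.mem_saturation.1 (WeylNull.exists_smul_mem_rowModule hUopen hUne h)
    obtain ⟨a, ha⟩ := WeylNull.exists_eq_sum_opMul hmem
    exact ⟨w, hw, a, (WeylNull.forall_eval_iff_smul_toRow_eq p q w a).2 ha⟩
  tfae_have 3 → 1 := fun ⟨_, hw, _, ha⟩ _ _ hu hp =>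
    WeylNull.eventually_eq_zero_of_smul_mem hw
      ((WeylNull.forall_eval_iff_smul_toRow_eq p q _ _).1 ha) hu hp
  tfae_finish
end

section
/- Let m, n, k be positive integers, let p_{ij} (1 ≤ i ≤ k, 1 ≤ j ≤ n) and q_1,…,q_n be linear partial differential operators with polynomial coefficients over ℝ in m variables, and suppose there exist a nonzero polynomial w ∈ ℝ[x₁,…,x_m] and operators h_1,…,h_k with polynomial coefficients such that for every j = 1,…,n and every polynomial function f : ℝ^m → ℝ one has w·(q_j[f]) = Σ_{i=1}^k h_i[p_{ij}[f]] as functions on ℝ^m. Then for every x⁰ ∈ ℝ^m and every n-tuple (u¹,…,uⁿ) of functions, each real-analytic on a neighborhood of x⁰, such that Σ_{j=1}^n p_{ij}[u^j] vanishes on a neighborhood of x⁰ for every i, the function Σ_{j=1}^n q_j[u^j] also vanishes on a neighborhood of x⁰. -/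
open scoped BigOperators
open Filter Topology MeasureTheory

section LocalDifferentialOperators

variable {𝕜 : Type*} [NontriviallyNormedField 𝕜] {m : ℕ}

theorem pderivOp_congr (i : Fin m) {x : Fin m → 𝕜} {v w : (Fin m → 𝕜) → 𝕜}
    (h : v =ᶠ[𝓝 x] w) : pderivOp i v =ᶠ[𝓝 x] pderivOp i w := by
  filter_upwards [h.fderiv (𝕜 := 𝕜)] with y hy
  simp only [pderivOp, hy]

/-- All partial derivatives of `v` of order less than `N` vanish at `x`. -/
def FlatAt (x : Fin m → 𝕜) : ℕ → ((Fin m → 𝕜) → 𝕜) → Prop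
  | 0, _ => True
  | N + 1, v => v x = 0 ∧ ∀ i, FlatAt x N (pderivOp i v)

theorem FlatAt.of_succ {x : Fin m → 𝕜} {N : ℕ} {v : (Fin m → 𝕜) → 𝕜}
    (h : FlatAt x (N + 1) v) : FlatAt x N v := by
  induction N generalizing v with
  | zero => trivial
  | succ N ih => exact ⟨h.1, fun i => ih (h.2 i)⟩

theorem FlatAt.mono {x : Fin m → 𝕜} {M N : ℕ} {v : (Fin m → 𝕜) → 𝕜}
    (h : FlatAt x N v) (hMN : M ≤ N) : FlatAt x M v := by
  induction N, hMN using Nat.le_induction with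
  | base => exact h
  | succ N _ ih => exact ih h.of_succ

theorem FlatAt.congr {x : Fin m → 𝕜} {N : ℕ} {v w : (Fin m → 𝕜) → 𝕜}
    (h : FlatAt x N v) (hvw : v =ᶠ[𝓝 x] w) : FlatAt x N w := by
  induction N generalizing v w with
  | zero => trivial
  | succ N ih =>
    exact ⟨hvw.self_of_nhds ▸ h.1, fun i => ih (h.2 i) (pderivOp_congr i hvw)⟩

theorem ContinuousMultilinearMap.exists_mvPolynomial_eval_diag {j : ℕ}
    (f : ContinuousMultilinearMap 𝕜 (fun _ : Fin j => Fin m → 𝕜) 𝕜) (x : Fin m → 𝕜) :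
    ∃ g : MvPolynomial (Fin m) 𝕜, ∀ y, MvPolynomial.eval y g = f fun _ => y - x := by
  classical
  refine ⟨∑ r : Fin j → Fin m, (∏ a, (MvPolynomial.X (r a) - MvPolynomial.C (x (r a)))) *
    MvPolynomial.C (f fun a => Pi.single (r a) 1), fun y => ?_⟩
  have hy : y - x = ∑ i, (y i - x i) • (Pi.single i 1 : Fin m → 𝕜) := by
    ext i
    simp [Finset.sum_apply, Pi.single_apply]
  conv_rhs => rw [hy, f.map_sum]
  simp [f.map_smul_univ]

/-- An operator on functions that acts additively and locally on germs of analytic functions and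
whose values at a point depend on finitely many derivatives only. -/
structure IsLocalDiffOp (L : ((Fin m → 𝕜) → 𝕜) → ((Fin m → 𝕜) → 𝕜)) : Prop where
  analyticAt : ∀ {x v}, AnalyticAt 𝕜 v x → AnalyticAt 𝕜 (L v) x
  congr : ∀ {x v w}, v =ᶠ[𝓝 x] w → L v =ᶠ[𝓝 x] L w
  add : ∀ {x v w}, AnalyticAt 𝕜 v x → AnalyticAt 𝕜 w x → L (v + w) =ᶠ[𝓝 x] L v + L w
  flat : ∃ d, ∀ {N x v}, AnalyticAt 𝕜 v x → FlatAt x (N + d) v → FlatAt x N (L v)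

namespace IsLocalDiffOp

variable {L M : ((Fin m → 𝕜) → 𝕜) → ((Fin m → 𝕜) → 𝕜)}

theorem id : IsLocalDiffOp (fun v : (Fin m → 𝕜) → 𝕜 => v) :=
  ⟨fun h => h, fun h => h, fun _ _ => .rfl, 0, fun _ h => h⟩

theorem comp (hL : IsLocalDiffOp L) (hM : IsLocalDiffOp M) :
    IsLocalDiffOp (fun v => L (M v)) := by
  obtain ⟨d, hd⟩ := hL.flat
  obtain ⟨e, he⟩ := hM.flat
  refine ⟨fun h => hL.analyticAt (hM.analyticAt h), fun h => hL.congr (hM.congr h),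
    fun hv hw => (hL.congr (hM.add hv hw)).trans (hL.add (hM.analyticAt hv) (hM.analyticAt hw)),
    d + e, fun {N x v} hv h => hd (hM.analyticAt hv) (he hv ?_)⟩
  rwa [add_assoc]

theorem iterate (hL : IsLocalDiffOp L) (n : ℕ) : IsLocalDiffOp L^[n] := by
  induction n with
  | zero => exact id
  | succ n ih => exact ih.comp hL

theorem map_zero (hL : IsLocalDiffOp L) (x : Fin m → 𝕜) : L 0 =ᶠ[𝓝 x] 0 := by
  have h := hL.add (x := x) (v := 0) (w := 0) analyticAt_const analyticAt_const
  rw [add_zero] at h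
  filter_upwards [h] with y hy
  simpa using hy

theorem map_sum (hL : IsLocalDiffOp L) {ι : Type*} {s : Finset ι} {x : Fin m → 𝕜}
    {v : ι → (Fin m → 𝕜) → 𝕜} (hv : ∀ i ∈ s, AnalyticAt 𝕜 (v i) x) :
    L (∑ i ∈ s, v i) =ᶠ[𝓝 x] ∑ i ∈ s, L (v i) := by
  classical
  induction s using Finset.induction_on with
  | empty => simpa using hL.map_zero x
  | insert a s ha ih =>
    rw [Finset.forall_mem_insert] at hv
    rw [Finset.sum_insert ha, Finset.sum_insert ha]
    exact (hL.add hv.1 (s.analyticAt_sum hv.2)).trans (.add .rfl (ih hv.2))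

end IsLocalDiffOp

variable [CompleteSpace 𝕜]

theorem AnalyticAt.pderivOp {x : Fin m → 𝕜} {v : (Fin m → 𝕜) → 𝕜}
    (hv : AnalyticAt 𝕜 v x) (i : Fin m) : AnalyticAt 𝕜 (pderivOp i v) x :=
  ((ContinuousLinearMap.apply 𝕜 𝕜 (Pi.single i 1 : Fin m → 𝕜)).analyticAt _).comp hv.fderiv

theorem pderivOp_add {x : Fin m → 𝕜} {v w : (Fin m → 𝕜) → 𝕜} (i : Fin m)
    (hv : AnalyticAt 𝕜 v x) (hw : AnalyticAt 𝕜 w x) :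
    pderivOp i (v + w) =ᶠ[𝓝 x] pderivOp i v + pderivOp i w := by
  filter_upwards [hv.eventually_analyticAt, hw.eventually_analyticAt] with y hy hy'
  simp [pderivOp, fderiv_add hy.differentiableAt hy'.differentiableAt]

theorem pderivOp_mul {x : Fin m → 𝕜} {v w : (Fin m → 𝕜) → 𝕜} (i : Fin m)
    (hv : AnalyticAt 𝕜 v x) (hw : AnalyticAt 𝕜 w x) :
    pderivOp i (v * w) =ᶠ[𝓝 x] v * pderivOp i w + pderivOp i v * w := by
  filter_upwards [hv.eventually_analyticAt, hw.eventually_analyticAt] with y hy hy'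
  simp [pderivOp, fderiv_mul hy.differentiableAt hy'.differentiableAt, mul_comm]

theorem FlatAt.add {x : Fin m → 𝕜} {N : ℕ} {v w : (Fin m → 𝕜) → 𝕜}
    (hv : AnalyticAt 𝕜 v x) (hw : AnalyticAt 𝕜 w x)
    (hfv : FlatAt x N v) (hfw : FlatAt x N w) : FlatAt x N (v + w) := by
  induction N generalizing v w with
  | zero => trivial
  | succ N ih =>
    refine ⟨by simp [hfv.1, hfw.1], fun i => ?_⟩
    exact (ih (hv.pderivOp i) (hw.pderivOp i) (hfv.2 i) (hfw.2 i)).congr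
      (pderivOp_add i hv hw).symm

theorem FlatAt.mul_left {x : Fin m → 𝕜} {N : ℕ} {c v : (Fin m → 𝕜) → 𝕜}
    (hc : AnalyticAt 𝕜 c x) (hv : AnalyticAt 𝕜 v x) (hfv : FlatAt x N v) :
    FlatAt x N (c * v) := by
  induction N generalizing c v with
  | zero => trivial
  | succ N ih =>
    refine ⟨by simp [hfv.1], fun i => ?_⟩
    exact (FlatAt.add (hc.mul (hv.pderivOp i)) ((hc.pderivOp i).mul hv)
      (ih hc (hv.pderivOp i) (hfv.2 i)) (ih (hc.pderivOp i) hv hfv.of_succ)).congr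
      (pderivOp_mul i hc hv).symm

theorem FlatAt.of_iteratedFDeriv_eq_zero {x : Fin m → 𝕜} {N : ℕ} {v : (Fin m → 𝕜) → 𝕜}
    (hv : AnalyticAt 𝕜 v x) (h : ∀ j < N, iteratedFDeriv 𝕜 j v x = 0) : FlatAt x N v := by
  induction N generalizing v with
  | zero => trivial
  | succ N ih =>
    refine ⟨?_, fun i => ih (hv.pderivOp i) fun j hj => ?_⟩
    · have := congrArg (fun f => f 0) (h 0 N.succ_pos)
      simpa using this
    · have hle := (ContinuousLinearMap.apply 𝕜 𝕜
        (Pi.single i 1 : Fin m → 𝕜)).norm_iteratedFDeriv_comp_left (n := j)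
        (hv.fderiv.contDiffAt (n := j)) le_rfl
      rw [norm_iteratedFDeriv_fderiv, h (j + 1) (by lia), norm_zero, mul_zero] at hle
      exact norm_le_zero_iff.1 hle

namespace IsLocalDiffOp

variable {L M : ((Fin m → 𝕜) → 𝕜) → ((Fin m → 𝕜) → 𝕜)}

theorem zero : IsLocalDiffOp (0 : ((Fin m → 𝕜) → 𝕜) → ((Fin m → 𝕜) → 𝕜)) := by
  refine ⟨fun _ => analyticAt_const, fun _ => .rfl, fun _ _ => ?_, 0, fun {N x v} hv _ => ?_⟩
  · simp
  · refine FlatAt.of_iteratedFDeriv_eq_zero analyticAt_const fun j _ => ?_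
    simp

theorem pderivOp (i : Fin m) : IsLocalDiffOp (pderivOp (𝕜 := 𝕜) i) :=
  ⟨fun h => h.pderivOp i, pderivOp_congr i, pderivOp_add i, 1, fun _ h => h.2 i⟩

theorem add_op (hL : IsLocalDiffOp L) (hM : IsLocalDiffOp M) : IsLocalDiffOp (L + M) := by
  obtain ⟨d, hd⟩ := hL.flat
  obtain ⟨e, he⟩ := hM.flat
  refine ⟨fun h => (hL.analyticAt h).add (hM.analyticAt h),
    fun h => (hL.congr h).add (hM.congr h), fun hv hw => ?_, d + e, fun {N x v} hv h => ?_⟩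
  · filter_upwards [hL.add hv hw, hM.add hv hw] with y h₁ h₂
    simp only [Pi.add_apply, h₁, h₂]
    ring
  · exact .add (hL.analyticAt hv) (hM.analyticAt hv) (hd hv (h.mono (by lia)))
      (he hv (h.mono (by lia)))

theorem sum {ι : Type*} {s : Finset ι} {L : ι → ((Fin m → 𝕜) → 𝕜) → ((Fin m → 𝕜) → 𝕜)}
    (hL : ∀ i ∈ s, IsLocalDiffOp (L i)) : IsLocalDiffOp (∑ i ∈ s, L i) :=
  Finset.sum_induction L IsLocalDiffOp (fun _ _ => add_op) zero hL

theorem mul_left (hL : IsLocalDiffOp L) {c : (Fin m → 𝕜) → 𝕜} (hc : ∀ x, AnalyticAt 𝕜 c x) :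
    IsLocalDiffOp (fun v => c * L v) := by
  obtain ⟨d, hd⟩ := hL.flat
  refine ⟨fun h => (hc _).mul (hL.analyticAt h), fun h => .mul .rfl (hL.congr h),
    fun hv hw => ?_, d, fun hv h => .mul_left (hc _) (hL.analyticAt hv) (hd hv h)⟩
  filter_upwards [hL.add hv hw] with y h
  simp only [Pi.mul_apply, h, Pi.add_apply, mul_add]

theorem iterPDeriv (α : Fin m → ℕ) : IsLocalDiffOp (iterPDeriv (𝕜 := 𝕜) α) := by
  unfold _root_.iterPDeriv
  induction List.finRange m with
  | nil => exact id
  | cons i l ih => exact ((pderivOp i).iterate (α i)).comp ih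

theorem app (p : PDO 𝕜 m) : IsLocalDiffOp p.app := by
  have h : p.app = ∑ α ∈ Finsupp.support p,
      fun v => (fun x => MvPolynomial.eval x (Finsupp.toFun p α)) * _root_.iterPDeriv α v := by
    ext v x
    simp only [Finset.sum_apply, Pi.mul_apply]
    rfl
  rw [h]
  exact sum fun α _ => (iterPDeriv α).mul_left fun x =>
    AnalyticOnNhd.eval_mvPolynomial _ x (Set.mem_univ x)

end IsLocalDiffOp

/-- Taylor approximation of an analytic function by a polynomial function. -/
theorem AnalyticAt.exists_mvPolynomial_flatAt_sub {x : Fin m → 𝕜} {v : (Fin m → 𝕜) → 𝕜}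
    (hv : AnalyticAt 𝕜 v x) (N : ℕ) :
    ∃ g : MvPolynomial (Fin m) 𝕜, FlatAt x N (v - fun y => MvPolynomial.eval y g) := by
  obtain ⟨P, hP⟩ := hv
  let Q : FormalMultilinearSeries 𝕜 (Fin m → 𝕜) 𝕜 := fun j => if j < N then P j else 0
  have hQ0 : ∀ j, N ≤ j → Q j = 0 := fun j hj => if_neg (by lia)
  have hrad : Q.radius = ⊤ := Q.radius_eq_top_of_eventually_eq_zero
    (Filter.eventually_atTop.2 ⟨N, hQ0⟩)
  have hQ : HasFPowerSeriesAt (fun z => Q.sum (z - x)) Q x := by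
    simpa using (Q.hasFPowerSeriesOnBall (by simp [hrad])).hasFPowerSeriesAt.comp_sub x
  choose g hg using fun j => (P j).exists_mvPolynomial_eval_diag x
  refine ⟨∑ j ∈ Finset.range N, g j, ?_⟩
  have hsum : (fun y => MvPolynomial.eval y (∑ j ∈ Finset.range N, g j)) =
      fun z => Q.sum (z - x) := by
    ext y
    rw [FormalMultilinearSeries.sum, tsum_eq_sum (s := Finset.range N), _root_.map_sum]
    · refine Finset.sum_congr rfl fun j hj => ?_
      rw [hg, show Q j = P j from if_pos (Finset.mem_range.1 hj)]
    · intro j hj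
      rw [hQ0 j (by simpa using hj), zero_apply]
  rw [hsum]
  obtain ⟨r, hr⟩ := hP.sub hQ
  refine .of_iteratedFDeriv_eq_zero hr.analyticAt fun j hj => ?_
  ext e
  rw [hr.iteratedFDeriv_eq_sum_of_completeSpace]
  have : (P - Q) j = 0 := by
    change P j - Q j = 0
    rw [show Q j = P j from if_pos hj, sub_self]
  simp [this]

theorem IsLocalDiffOp.eq_of_eq_on_polynomials
    {L M : ((Fin m → 𝕜) → 𝕜) → ((Fin m → 𝕜) → 𝕜)} (hL : IsLocalDiffOp L) (hM : IsLocalDiffOp M)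
    (h : ∀ (g : MvPolynomial (Fin m) 𝕜) (x : Fin m → 𝕜),
      L (fun y => MvPolynomial.eval y g) x = M (fun y => MvPolynomial.eval y g) x)
    {x : Fin m → 𝕜} {v : (Fin m → 𝕜) → 𝕜} (hv : AnalyticAt 𝕜 v x) : L v x = M v x := by
  obtain ⟨d, hd⟩ := hL.flat
  obtain ⟨e, he⟩ := hM.flat
  obtain ⟨g, hg⟩ := hv.exists_mvPolynomial_flatAt_sub (1 + (d + e))
  have hga : AnalyticAt 𝕜 (fun y => MvPolynomial.eval y g) x :=
    AnalyticOnNhd.eval_mvPolynomial _ x (Set.mem_univ x)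
  have hsub := hv.sub hga
  have hL' := (hL.add hga hsub).self_of_nhds
  have hM' := (hM.add hga hsub).self_of_nhds
  rw [add_sub_cancel, Pi.add_apply] at hL' hM'
  rw [hL', hM', h, (hd (N := 1) hsub (hg.mono (by lia))).1,
    (he (N := 1) hsub (hg.mono (by lia))).1]

end LocalDifferentialOperators

theorem MvPolynomial.not_eventually_eval_eq_zero {m : ℕ} {w : MvPolynomial (Fin m) ℝ}
    (hw : w ≠ 0) (x : Fin m → ℝ) : ¬ ∀ᶠ y in 𝓝 x, MvPolynomial.eval y w = 0 := by
  intro h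
  refine hw (MvPolynomial.funext fun y => ?_)
  have := (AnalyticOnNhd.eval_mvPolynomial w).eq_of_eventuallyEq
    (g := fun _ => 0) (fun _ _ => analyticAt_const) h
  simpa using congrFun this y

/-- Implication (2) ⇒ (1) of the paper's main theorem, over ℝ. -/
theorem weyl_closure_membership_implies_vanishing
    (m n k : ℕ) (hm : 0 < m) (hn : 0 < n) (hk : 0 < k)
    (p : Fin k → Fin n → PDO ℝ m) (q : Fin n → PDO ℝ m)
    (w : MvPolynomial (Fin m) ℝ) (hw : w ≠ 0) (h : Fin k → PDO ℝ m)
    (hmod : ∀ (j : Fin n) (g : MvPolynomial (Fin m) ℝ) (x : Fin m → ℝ),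
      MvPolynomial.eval x w * PDO.app (q j) (fun y => MvPolynomial.eval y g) x =
        ∑ i, PDO.app (h i) (PDO.app (p i j) (fun y => MvPolynomial.eval y g)) x) :
    ∀ (x₀ : Fin m → ℝ) (u : Fin n → (Fin m → ℝ) → ℝ),
      (∀ j, AnalyticAt ℝ (u j) x₀) →
      (∀ i, ∀ᶠ x in 𝓝 x₀, ∑ j, PDO.app (p i j) (u j) x = 0) →
      (∀ᶠ x in 𝓝 x₀, ∑ j, PDO.app (q j) (u j) x = 0) := by
  intro x₀ u hu hpu
  have hmod' : ∀ j, ∀ᶠ x in 𝓝 x₀, MvPolynomial.eval x w * (q j).app (u j) x =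
      ∑ i, (h i).app ((p i j).app (u j)) x := by
    intro j
    filter_upwards [(hu j).eventually_analyticAt] with x hx
    have hL : IsLocalDiffOp (fun v => (fun y => MvPolynomial.eval y w) * (q j).app v) :=
      (IsLocalDiffOp.app (q j)).mul_left fun x =>
        AnalyticOnNhd.eval_mvPolynomial _ x (Set.mem_univ x)
    have hM : IsLocalDiffOp (∑ i, fun v => (h i).app ((p i j).app v)) :=
      .sum fun i _ => (IsLocalDiffOp.app (h i)).comp (IsLocalDiffOp.app (p i j))
    have := hL.eq_of_eq_on_polynomials hM
      (fun g x => by simpa [Finset.sum_apply] using hmod j g x) hx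
    simpa [Finset.sum_apply] using this
  have hzero : ∀ i, ∀ᶠ x in 𝓝 x₀, ∑ j, (h i).app ((p i j).app (u j)) x = 0 := by
    intro i
    have h₁ := (IsLocalDiffOp.app (h i)).map_sum (s := Finset.univ)
      fun j _ => (IsLocalDiffOp.app (p i j)).analyticAt (hu j)
    have h₂ : ∑ j, (p i j).app (u j) =ᶠ[𝓝 x₀] 0 := by
      filter_upwards [hpu i] with x hx
      simpa [Finset.sum_apply] using hx
    filter_upwards [h₁, (IsLocalDiffOp.app (h i)).congr h₂,
      (IsLocalDiffOp.app (h i)).map_zero x₀] with x hx₁ hx₂ hx₃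
    rw [← Finset.sum_apply, ← hx₁, hx₂, hx₃, Pi.zero_apply]
  have hw_mul : ∀ᶠ x in 𝓝 x₀, MvPolynomial.eval x w * ∑ j, (q j).app (u j) x = 0 := by
    filter_upwards [eventually_all.2 hmod', eventually_all.2 hzero] with x hx hx'
    rw [Finset.mul_sum, Finset.sum_congr rfl fun j _ => hx j, Finset.sum_comm]
    exact Finset.sum_eq_zero fun i _ => hx' i
  have hqu : AnalyticAt ℝ (fun x => ∑ j, (q j).app (u j) x) x₀ :=
    Finset.univ.analyticAt_fun_sum fun j _ => (IsLocalDiffOp.app (q j)).analyticAt (hu j)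
  filter_upwards [eventually_eventually_nhds.2 hw_mul, hqu.eventually_analyticAt] with x hx hqx
  by_contra hne
  refine MvPolynomial.not_eventually_eval_eq_zero hw x ?_
  filter_upwards [hx, hqx.continuousAt.eventually_ne hne] with y hy hy'
  exact (mul_eq_zero.1 hy).resolve_right hy'
end

section
/- Let 𝕜 be ℝ or ℂ, let m, t be positive integers, let k be a positive integer, and let g_1,…,g_k, f be vectors in (𝕜[x₁,…,x_m])^t (i.e., t-tuples of polynomials). Then the following are equivalent: (1) there exists a nonempty open subset W ⊆ 𝕜^m such that for every x⁰ ∈ W and every c ∈ 𝕜^t satisfying Σ_{l=1}^t g_j(x⁰)_l · c_l = 0 for all j = 1,…,k, one also has Σ_{l=1}^t f(x⁰)_l · c_l = 0; (2) there exist a nonzero polynomial w ∈ 𝕜[x₁,…,x_m] and polynomials h_1,…,h_k ∈ 𝕜[x₁,…,x_m] such that w·f = Σ_{j=1}^k h_j·g_j in (𝕜[x₁,…,x_m])^t. -/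
open scoped BigOperators

/-- A polynomial vanishing on a nonempty open set is zero. -/
theorem MvPolynomial.eq_zero_of_eval_eq_zero_of_isOpen {R σ : Type*} [CommRing R] [IsDomain R]
    [TopologicalSpace R] [T1Space R] [∀ r : R, (nhdsWithin r {r}ᶜ).NeBot] [Finite σ]
    {W : Set (σ → R)} (hW : IsOpen W) (hne : W.Nonempty) {p : MvPolynomial σ R}
    (hp : ∀ x ∈ W, MvPolynomial.eval x p = 0) : p = 0 := by
  obtain ⟨a, ha⟩ := hne
  obtain ⟨u, hu, huW⟩ := isOpen_pi_iff'.mp hW a ha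
  refine MvPolynomial.funext_set u
    (fun i => infinite_of_mem_nhds (a i) ((hu i).1.mem_nhds (hu i).2)) fun x hx => ?_
  rw [hp x (huW hx), map_zero]

/-- Over an integral domain, a vector without nonzero multiple in the span of a finite family is
separated from this family by a linear form with coefficients in the domain. -/
theorem exists_dotProduct_ne_zero_of_forall_smul_ne_sum {R ι n : Type*} [CommRing R] [IsDomain R]
    [Fintype ι] [Fintype n] (v : ι → n → R) (x : n → R)
    (hx : ¬ ∃ w : R, w ≠ 0 ∧ ∃ h : ι → R, ∀ l, w * x l = ∑ j, h j * v j l) :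
    ∃ c : n → R, (∀ j, ∑ l, v j l * c l = 0) ∧ ∑ l, x l * c l ≠ 0 := by
  classical
  let K := FractionRing R
  let φ : (n → R) → n → K := fun y l => algebraMap R K (y l)
  have hinj : Function.Injective (algebraMap R K) := IsFractionRing.injective R K
  have hmem : φ x ∉ Submodule.span K (Set.range fun j => φ (v j)) := by
    intro hspan
    obtain ⟨a, ha⟩ := (Submodule.mem_span_range_iff_exists_fun K).mp hspan
    obtain ⟨b, hb⟩ := IsLocalization.exist_integer_multiples_of_finite (nonZeroDivisors R) a
    choose h hh using hb
    refine hx ⟨b, nonZeroDivisors.ne_zero b.2, h, fun l => hinj ?_⟩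
    have hl : ∑ j, a j * algebraMap R K (v j l) = algebraMap R K (x l) := by
      simpa [φ] using congrFun ha l
    simp only [map_mul, map_sum, hh, ← hl, Finset.mul_sum, Algebra.smul_def, mul_assoc]
  obtain ⟨F, hFx, hF⟩ := Submodule.exists_dual_map_eq_bot_of_notMem hmem inferInstance
  obtain ⟨b, hb⟩ := IsLocalization.exist_integer_multiples_of_finite (nonZeroDivisors R)
    fun l => F (Pi.single l 1)
  choose c hc using hb
  have key (y : n → R) :
      algebraMap R K (∑ l, y l * c l) = algebraMap R K b * F (φ y) := by
    rw [LinearMap.pi_apply_eq_sum_univ F (φ y)]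
    simp only [map_mul, map_sum, hc, Finset.mul_sum, Algebra.smul_def, φ, Algebra.algebraMap_self,
      RingHom.id_apply]
    refine Finset.sum_congr rfl fun l _ => ?_
    rw [mul_left_comm]
    congr! 4 with i
    simp [Pi.single_apply, eq_comm]
  refine ⟨c, fun j => hinj ?_, fun h0 => ?_⟩
  · have hj : F (φ (v j)) = 0 := by
      rw [← Submodule.mem_bot K, ← hF]
      exact Submodule.mem_map_of_mem (Submodule.subset_span ⟨j, rfl⟩)
    rw [key, hj, mul_zero, map_zero]
  · have hkey := key x
    rw [h0, map_zero, eq_comm, mul_eq_zero] at hkey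
    refine hkey.elim (fun h => nonZeroDivisors.ne_zero b.2 (hinj ?_)) hFx
    rw [h, map_zero]

/-- Lemma `lem1` of the paper, in denominator-cleared polynomial form:
pointwise linear dependence on a nonempty open set is equivalent to
membership in the `𝕜(x)`-span. Here `𝕜` is `ℝ` or `ℂ`. -/
theorem pointwise_dependence_iff_rational_span
    {𝕜 : Type*} [RCLike 𝕜]
    (m t k : ℕ) (hm : 0 < m) (ht : 0 < t) (hk : 0 < k)
    (g : Fin k → Fin t → MvPolynomial (Fin m) 𝕜)
    (f : Fin t → MvPolynomial (Fin m) 𝕜) :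
    (∃ W : Set (Fin m → 𝕜), IsOpen W ∧ W.Nonempty ∧
      ∀ x ∈ W, ∀ c : Fin t → 𝕜,
        (∀ j : Fin k, ∑ l, MvPolynomial.eval x (g j l) * c l = 0) →
        ∑ l, MvPolynomial.eval x (f l) * c l = 0) ↔
    (∃ w : MvPolynomial (Fin m) 𝕜, w ≠ 0 ∧
      ∃ h : Fin k → MvPolynomial (Fin m) 𝕜,
        ∀ l : Fin t, w * f l = ∑ j, h j * g j l) := by
  constructor
  · rintro ⟨W, hW, hne, hdep⟩
    by_contra hspan
    obtain ⟨c, hgc, hfc⟩ := exists_dotProduct_ne_zero_of_forall_smul_ne_sum g f hspan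
    refine hfc (MvPolynomial.eq_zero_of_eval_eq_zero_of_isOpen hW hne fun x hx => ?_)
    have h := hdep x hx (fun l => MvPolynomial.eval x (c l)) fun j => by
      simpa using congrArg (MvPolynomial.eval x) (hgc j)
    simpa using h
  · rintro ⟨w, hw, h, hwf⟩
    refine ⟨{x | MvPolynomial.eval x w ≠ 0},
      isOpen_ne_fun (MvPolynomial.continuous_eval w) continuous_const, ?_, ?_⟩
    · by_contra hempty
      refine hw (MvPolynomial.funext fun x => ?_)
      by_contra hx
      exact hempty ⟨x, by simpa using hx⟩
    · intro x hx c hc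
      refine (mul_eq_zero.mp ?_).resolve_left hx
      have hx' (l : Fin t) : MvPolynomial.eval x w * MvPolynomial.eval x (f l) =
          ∑ j, MvPolynomial.eval x (h j) * MvPolynomial.eval x (g j l) := by
        simpa using congrArg (MvPolynomial.eval x) (hwf l)
      simp only [Finset.mul_sum, ← mul_assoc, hx', Finset.sum_mul]
      rw [Finset.sum_comm]
      simp only [mul_assoc, ← Finset.mul_sum, hc, mul_zero, Finset.sum_const_zero]
end

section
/- Let u be a function holomorphic on ℂ \ {0} such that z²·u''(z) − z·u'(z) + (3/4)·u(z) = 0 for all z ∈ ℂ \ {0}. Then u is identically zero on ℂ \ {0}. -/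
/-- A holomorphic solution of `z f' = a f` on `ℂ \ {0}` vanishes when its monodromy factor
`exp (2πia)` is not `1`. -/
theorem eq_zero_of_mul_deriv_eq_mul {f : ℂ → ℂ} {a : ℂ}
    (hf : DifferentiableOn ℂ f {(0 : ℂ)}ᶜ)
    (ha : Complex.exp (2 * Real.pi * Complex.I * a) ≠ 1)
    (heq : ∀ z : ℂ, z ≠ 0 → z * deriv f z = a * f z) {z : ℂ} (hz : z ≠ 0) : f z = 0 := by
  have hd (t : ℂ) : HasDerivAt (fun t => f (Complex.exp t) * Complex.exp (-(a * t))) 0 t := by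
    have h₁ : HasDerivAt f (deriv f (Complex.exp t)) (Complex.exp t) :=
      (hf.differentiableAt (isOpen_compl_singleton.mem_nhds (Complex.exp_ne_zero t))).hasDerivAt
    have h₂ : HasDerivAt (fun t => f (Complex.exp t) * Complex.exp (-(a * t)))
        (deriv f (Complex.exp t) * Complex.exp t * Complex.exp (-(a * t)) +
          f (Complex.exp t) * (Complex.exp (-(a * t)) * -(a * 1))) t :=
      (h₁.comp t (Complex.hasDerivAt_exp t)).mul ((hasDerivAt_id t).const_mul a).neg.cexp
    refine h₂.congr_deriv ?_
    linear_combination Complex.exp (-(a * t)) * heq _ (Complex.exp_ne_zero t)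
  have hconst := is_const_of_deriv_eq_zero (fun t => (hd t).differentiableAt)
    (fun t => (hd t).deriv) (Complex.log z) (Complex.log z + 2 * Real.pi * Complex.I)
  have hsplit : Complex.exp (-(a * Complex.log z)) =
      Complex.exp (-(a * (Complex.log z + 2 * Real.pi * Complex.I))) *
        Complex.exp (2 * Real.pi * Complex.I * a) := by
    rw [← Complex.exp_add]
    ring_nf
  simp only [Complex.exp_periodic _, Complex.exp_log hz, hsplit] at hconst
  by_contra hne
  refine ha (mul_left_cancel₀ (mul_ne_zero hne (Complex.exp_ne_zero
    (-(a * (Complex.log z + 2 * Real.pi * Complex.I))))) ?_)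
  linear_combination hconst

/-- Example `singex2` of the paper: the Euler equation
`z²u'' − zu' + (3/4)u = 0` has no nonzero holomorphic solution on `ℂ \ {0}`. -/
theorem euler_equation_no_nonzero_solution_on_punctured_plane
    (u : ℂ → ℂ) (hu : DifferentiableOn ℂ u {(0 : ℂ)}ᶜ)
    (heq : ∀ z : ℂ, z ≠ 0 →
      z ^ 2 * deriv (deriv u) z - z * deriv u z + (3 / 4 : ℂ) * u z = 0) :
    ∀ z : ℂ, z ≠ 0 → u z = 0 := by
  have hu' : DifferentiableOn ℂ (deriv u) {(0 : ℂ)}ᶜ := hu.deriv isOpen_compl_singleton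
  have hhalf : Complex.exp (2 * Real.pi * Complex.I * (1 / 2)) ≠ 1 := by
    rw [show 2 * (Real.pi : ℂ) * Complex.I * (1 / 2) = Real.pi * Complex.I by ring,
      Complex.exp_pi_mul_I]
    norm_num
  have hthree : Complex.exp (2 * Real.pi * Complex.I * (3 / 2)) ≠ 1 := by
    rw [show 2 * (Real.pi : ℂ) * Complex.I * (3 / 2) =
        Real.pi * Complex.I + 2 * Real.pi * Complex.I by ring,
      Complex.exp_periodic, Complex.exp_pi_mul_I]
    norm_num
  have hv (z : ℂ) (hz : z ≠ 0) : z * deriv u z - 3 / 2 * u z = 0 := by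
    refine eq_zero_of_mul_deriv_eq_mul (f := fun z => z * deriv u z - 3 / 2 * u z)
      ((differentiableOn_id.mul hu').sub (hu.const_mul _)) hhalf (fun w hw => ?_) hz
    have hw' := isOpen_compl_singleton.mem_nhds (show w ∈ ({(0 : ℂ)}ᶜ : Set ℂ) from hw)
    have h : HasDerivAt (fun z => z * deriv u z - 3 / 2 * u z)
        (1 * deriv u w + w * deriv (deriv u) w - 3 / 2 * deriv u w) w :=
      ((hasDerivAt_id w).mul (hu'.differentiableAt hw').hasDerivAt).sub
        ((hu.differentiableAt hw').hasDerivAt.const_mul _)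
    rw [h.deriv]
    linear_combination heq w hw
  exact fun z hz => eq_zero_of_mul_deriv_eq_mul hu hthree
    (fun w hw => sub_eq_zero.mp (hv w hw)) hz
end

section
/- Let u : ℝ → ℝ be a Schwartz function (rapidly decreasing smooth function) such that −u''(x) + (x² − 1)·u(x) = 0 for all x ∈ ℝ. Then u'(x) + x·u(x) = 0 for all x ∈ ℝ. -/
theorem eq_zero_of_bounded_of_hasDerivAt_mul_self {w : ℝ → ℝ} {C : ℝ}
    (hw : ∀ x, HasDerivAt w (x * w x) x) (hC : ∀ x, |w x| ≤ C) (x : ℝ) : w x = 0 := by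
  have hd : ∀ y, HasDerivAt (fun t => w t * Real.exp (-t ^ 2 / 2)) 0 y := fun y => by
    have h : HasDerivAt (fun t : ℝ => -t ^ 2 / 2) (-y) y := by
      refine ((hasDerivAt_pow 2 y).neg.div_const 2).congr_deriv ?_
      push_cast
      ring
    refine ((hw y).mul h.exp).congr_deriv ?_
    ring
  have hconst : ∀ y, w y * Real.exp (-y ^ 2 / 2) = w 0 := fun y => by
    simpa using is_const_of_deriv_eq_zero (fun z => (hd z).differentiableAt)
      (fun z => (hd z).deriv) y 0
  have hsol : ∀ y, w y = w 0 * Real.exp (y ^ 2 / 2) := fun y => by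
    rw [← hconst y, mul_assoc, ← Real.exp_add]
    ring_nf
    simp
  suffices h0 : w 0 = 0 by rw [hsol, h0, zero_mul]
  by_contra h0
  have hpos : 0 < |w 0| := abs_pos.2 h0
  have hC0 : 0 ≤ C := (abs_nonneg _).trans (hC 0)
  have hb := hC (Real.sqrt (2 * (C / |w 0|)))
  rw [hsol, abs_mul, abs_of_pos (Real.exp_pos _), Real.sq_sqrt (by positivity),
    mul_div_cancel_left₀ _ two_ne_zero] at hb
  have hexp := mul_le_mul_of_nonneg_left (Real.add_one_le_exp (C / |w 0|)) hpos.le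
  rw [mul_add, mul_div_cancel₀ _ hpos.ne'] at hexp
  linarith

theorem SchwartzMap.exists_abs_deriv_add_mul_self_le (u : SchwartzMap ℝ ℝ) :
    ∃ C, ∀ x : ℝ, |deriv u x + x * u x| ≤ C := by
  refine ⟨SchwartzMap.seminorm ℝ 0 1 u + SchwartzMap.seminorm ℝ 1 0 u, fun x => ?_⟩
  have h1 := u.le_seminorm' ℝ 0 1 x
  have h2 := u.le_seminorm' ℝ 1 0 x
  simp only [pow_zero, one_mul, iteratedDeriv_one, Real.norm_eq_abs, pow_one,
    iteratedDeriv_zero, ← abs_mul] at h1 h2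
  exact (abs_add_le _ _).trans (add_le_add h1 h2)


/-- Example `sexample` of the paper: every Schwartz solution of
`−u'' + (x² − 1)u = 0` also satisfies `u' + xu = 0`, i.e. `D + x` belongs to
the 𝒮-closure of `−D² + x² − 1`. -/
theorem schwartz_solution_of_hermite_equation
    (u : SchwartzMap ℝ ℝ)
    (hu : ∀ x : ℝ,
      -deriv (deriv (⇑u)) x + (x ^ 2 - 1) * u x = 0) :
    ∀ x : ℝ, deriv (⇑u) x + x * u x = 0 := by
  obtain ⟨C, hC⟩ := u.exists_abs_deriv_add_mul_self_le
  refine eq_zero_of_bounded_of_hasDerivAt_mul_self (fun x => ?_) hC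
  have hu2 : ContDiff ℝ 2 u := u.smooth 2
  have hu' : Differentiable ℝ (deriv u) :=
    (contDiff_succ_iff_deriv.1 (show ContDiff ℝ (1 + 1) u by exact_mod_cast hu2)).2.2.differentiable
      one_ne_zero
  refine ((hu' x).hasDerivAt.add
    ((hasDerivAt_id x).mul (u.differentiableAt (x := x)).hasDerivAt)).congr_deriv ?_
  simp only [id]
  linear_combination -hu x
end

section
/- Define v : ℝ → ℝ by v(x) = e^{−x²/2} · ∫₀^x e^{t²} dt. Then for all x ∈ ℝ: (a) −v''(x) + (x² − 1)·v(x) = 0, and (b) v'(x) + x·v(x) = e^{x²/2}. In particular, v is a real-analytic solution of the equation −u'' + (x² − 1)u = 0 on ℝ for which the function u' + x·u is nowhere zero. -/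
/-- The integral of the restriction to `ℝ` of an entire function is real-analytic in its upper
bound. -/
theorem analyticAt_intervalIntegral_of_entire {F : ℂ → ℂ} (hF : Differentiable ℂ F)
    (a x : ℝ) : AnalyticAt ℝ (fun y : ℝ => ∫ t in a..y, (F t).re) x := by
  obtain ⟨G, hG⟩ := hF.isExactOn_univ
  have hdiff : Differentiable ℂ G := fun z => (hG z trivial).differentiableAt
  have hcont : Continuous fun t : ℝ => (F t).re :=
    Complex.continuous_re.comp (hF.continuous.comp Complex.continuous_ofReal)
  have hint : (fun y : ℝ => ∫ t in a..y, (F t).re) = fun y : ℝ => (G y).re - (G a).re := by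
    funext y
    exact intervalIntegral.integral_eq_sub_of_hasDerivAt
      (fun t _ => (hG t trivial).real_of_complex) (hcont.intervalIntegrable a y)
  rw [hint]
  exact (hdiff.analyticAt (x : ℂ)).re_ofReal.sub analyticAt_const

theorem hasDerivAt_exp_neg_sq_div_two_mul_integral (x : ℝ) :
    HasDerivAt (fun x : ℝ => Real.exp (-x ^ 2 / 2) * ∫ t in (0 : ℝ)..x, Real.exp (t ^ 2))
      (Real.exp (x ^ 2 / 2) -
        x * (Real.exp (-x ^ 2 / 2) * ∫ t in (0 : ℝ)..x, Real.exp (t ^ 2))) x := by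
  have hgauss : HasDerivAt (fun y : ℝ => Real.exp (-y ^ 2 / 2))
      (Real.exp (-x ^ 2 / 2) * -x) x := by
    convert! (((hasDerivAt_pow 2 x).neg).div_const 2).exp using 1
    simp only [Nat.cast_ofNat, Nat.add_one_sub_one, pow_one, Pi.neg_apply]
    ring
  have hcont : Continuous fun t : ℝ => Real.exp (t ^ 2) := by fun_prop
  have hint := hcont.integral_hasStrictDerivAt 0 x |>.hasDerivAt
  have hexp : Real.exp (-x ^ 2 / 2) * Real.exp (x ^ 2) = Real.exp (x ^ 2 / 2) := by
    rw [← Real.exp_add]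
    ring_nf
  convert! hgauss.mul hint using 1
  rw [hexp]
  ring

/-- Example `sexample` of the paper: the function
`v(x) = e^{−x²/2}·∫₀ˣ e^{t²} dt` is a real-analytic solution of
`−v'' + (x² − 1)v = 0` with `v' + xv = e^{x²/2}`, hence `v' + xv` is
nowhere zero. -/
theorem second_solution_of_hermite_equation :
    let v : ℝ → ℝ := fun x => Real.exp (-x ^ 2 / 2) * ∫ t in (0 : ℝ)..x, Real.exp (t ^ 2)
    (∀ x : ℝ, -deriv (deriv v) x + (x ^ 2 - 1) * v x = 0) ∧
    (∀ x : ℝ, deriv v x + x * v x = Real.exp (x ^ 2 / 2)) ∧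
    (∀ x : ℝ, AnalyticAt ℝ v x) ∧
    (∀ x : ℝ, deriv v x + x * v x ≠ 0) := by
  intro v
  have hv : ∀ x, HasDerivAt v (Real.exp (x ^ 2 / 2) - x * v x) x :=
    hasDerivAt_exp_neg_sq_div_two_mul_integral
  have hderiv : deriv v = fun x => Real.exp (x ^ 2 / 2) - x * v x := funext fun x => (hv x).deriv
  have hfirst : ∀ x : ℝ, deriv v x + x * v x = Real.exp (x ^ 2 / 2) := fun x => by
    rw [(hv x).deriv, sub_add_cancel]
  refine ⟨fun x => ?_, hfirst, fun x => ?_, fun x => ?_⟩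
  · have hexp : HasDerivAt (fun y : ℝ => Real.exp (y ^ 2 / 2)) (Real.exp (x ^ 2 / 2) * x) x := by
      convert! ((hasDerivAt_pow 2 x).div_const 2).exp using 1
      simp
    have hsecond : HasDerivAt (fun x => Real.exp (x ^ 2 / 2) - x * v x)
        (Real.exp (x ^ 2 / 2) * x - (1 * v x + x * (Real.exp (x ^ 2 / 2) - x * v x))) x :=
      hexp.sub ((hasDerivAt_id x).mul (hv x))
    rw [hderiv, hsecond.deriv]
    ring
  · have hgauss : AnalyticAt ℝ (fun y : ℝ => Real.exp (-y ^ 2 / 2)) x := by fun_prop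
    have hentire : Differentiable ℂ fun z : ℂ => Complex.exp (z ^ 2) := by fun_prop
    have hre : ∀ t : ℝ, (Complex.exp ((t : ℂ) ^ 2)).re = Real.exp (t ^ 2) := fun t => by
      rw [← Complex.ofReal_pow, Complex.exp_ofReal_re]
    have hint := analyticAt_intervalIntegral_of_entire hentire 0 x
    simp only [hre] at hint
    exact hgauss.mul hint
  · rw [hfirst]
    exact (Real.exp_pos _).ne'
end

section
/- Let m, n, r, s, w be positive integers. Let g_1,…,g_r, p_1,…,p_s, h_1,…,h_w, q_1,…,q_w each be n-tuples of linear partial differential operators with polynomial coefficients over ℝ in m variables. Let S denote the set of all n-tuples u = (u₁,…,u_n) of Schwartz functions on ℝ^m such that Σ_{b=1}^n g_{l,b}[u_b] = 0 on ℝ^m for every l = 1,…,r. Assume: (i) every q_j vanishes on S, i.e., for every u ∈ S and every j, Σ_{b=1}^n q_{j,b}[u_b] = 0 on ℝ^m; and (ii) for all indices a, b ∈ {1,…,n} and every smooth function f : ℝ^m → ℝ, Σ_{i=1}^s (p_{i,a})*[p_{i,b}[f]] = Σ_{j=1}^w ( (h_{j,a})*[q_{j,b}[f]] + (q_{j,a})*[h_{j,b}[f]]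 ) as functions on ℝ^m. Then every p_i vanishes on S, i.e., for every u ∈ S and every i, Σ_{b=1}^n p_{i,b}[u_b] = 0 on ℝ^m. -/
open scoped BigOperators
open Filter Topology MeasureTheory

/-- The formal adjoint action `p*[v] = ∑_α (−1)^{|α|} ∂^α (p_α ⬝ v)`. -/
noncomputable def PDO.adjApp {m : ℕ} (p : PDO ℝ m)
    (v : (Fin m → ℝ) → ℝ) : (Fin m → ℝ) → ℝ :=
  fun x => Finsupp.sum p (fun α c =>
    (-1 : ℝ) ^ (∑ i, α i) *
      iterPDeriv α (fun y => MvPolynomial.eval y c * v y) x)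

open scoped SchwartzMap

/-- The `L²` pairing of Schwartz functions. -/
noncomputable def l2Form (m : ℕ) : LinearMap.BilinForm ℝ 𝓢(Fin m → ℝ, ℝ) :=
  have hint (φ ψ : 𝓢(Fin m → ℝ, ℝ)) : Integrable fun x => φ x * ψ x :=
    (SchwartzMap.pairing (ContinuousLinearMap.mul ℝ ℝ) φ ψ).integrable
  LinearMap.mk₂ ℝ (fun φ ψ => ∫ x, φ x * ψ x)
    (fun φ φ' ψ => by
      simp only [_root_.add_apply, add_mul]
      exact integral_add (hint φ ψ) (hint φ' ψ))
    (fun c φ ψ => by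
      simp only [_root_.smul_apply, smul_eq_mul, mul_assoc]
      exact integral_const_mul c _)
    (fun φ ψ ψ' => by
      simp only [_root_.add_apply, mul_add]
      exact integral_add (hint φ ψ) (hint φ ψ'))
    (fun c φ ψ => by
      simp only [_root_.smul_apply, smul_eq_mul, mul_left_comm _ c]
      exact integral_const_mul c _)

theorem l2Form_apply {m : ℕ} (φ ψ : 𝓢(Fin m → ℝ, ℝ)) :
    l2Form m φ ψ = ∫ x, φ x * ψ x := rfl

theorem l2Form_self_nonneg {m : ℕ} (φ : 𝓢(Fin m → ℝ, ℝ)) : 0 ≤ l2Form m φ φ :=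
  integral_nonneg fun x => mul_self_nonneg (φ x)

theorem eq_zero_of_l2Form_self {m : ℕ} {φ : 𝓢(Fin m → ℝ, ℝ)} (h : l2Form m φ φ = 0) :
    φ = 0 := by
  ext x
  by_contra hx
  exact (integral_pos_of_integrable_nonneg_nonzero (μ := volume) (x := x)
    (f := fun x => φ x * φ x) (φ.continuous.mul φ.continuous)
    (SchwartzMap.pairing (ContinuousLinearMap.mul ℝ ℝ) φ φ).integrable
    (fun x => mul_self_nonneg (φ x)) (mul_self_ne_zero.2 hx)).ne' h

/-- The partial derivative as an endomorphism of Schwartz space. -/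
noncomputable def schwartzPDeriv {m : ℕ} (i : Fin m) : Module.End ℝ 𝓢(Fin m → ℝ, ℝ) :=
  (LineDeriv.lineDerivOpCLM ℝ 𝓢(Fin m → ℝ, ℝ) (Pi.single i 1 : Fin m → ℝ)).toLinearMap

theorem coe_schwartzPDeriv {m : ℕ} (i : Fin m) (φ : 𝓢(Fin m → ℝ, ℝ)) :
    ⇑(schwartzPDeriv i φ) = pderivOp i φ := rfl

theorem commute_schwartzPDeriv {m : ℕ} (i j : Fin m) :
    Commute (schwartzPDeriv i) (schwartzPDeriv j) := by
  have key (i j : Fin m) (φ : 𝓢(Fin m → ℝ, ℝ)) (x : Fin m → ℝ) :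
      schwartzPDeriv i (schwartzPDeriv j φ) x =
        fderiv ℝ (fderiv ℝ φ) x (Pi.single i 1) (Pi.single j 1) := by
    have h : DifferentiableAt ℝ (fderiv ℝ φ) x :=
      (SchwartzMap.fderivCLM ℝ (Fin m → ℝ) ℝ φ).differentiableAt
    change fderiv ℝ (fun y => fderiv ℝ φ y (Pi.single j 1)) x (Pi.single i 1) = _
    rw [fderiv_clm_apply h (differentiableAt_const _)]
    simp
  refine LinearMap.ext fun φ => SchwartzMap.ext fun x => ?_
  rw [Module.End.mul_apply, Module.End.mul_apply, key, key]
  exact second_derivative_symmetric (fun y => φ.hasFDerivAt y)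
    (SchwartzMap.fderivCLM ℝ (Fin m → ℝ) ℝ φ).differentiableAt.hasFDerivAt _ _

theorem isAdjointPair_schwartzPDeriv {m : ℕ} (i : Fin m) :
    LinearMap.IsAdjointPair (l2Form m) (l2Form m) (schwartzPDeriv i)
      (-schwartzPDeriv i : Module.End ℝ 𝓢(Fin m → ℝ, ℝ)) := by
  intro φ ψ
  have h := SchwartzMap.integral_mul_lineDerivOp_right_eq_neg_left (μ := volume) φ ψ
    (Pi.single i 1)
  rw [LinearMap.neg_apply, map_neg]
  exact neg_eq_iff_eq_neg.1 h.symm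

theorem LinearMap.IsAdjointPair.pow {R M : Type*} [CommRing R] [AddCommGroup M] [Module R M]
    {B : LinearMap.BilinForm R M} {f f' : Module.End R M}
    (h : LinearMap.IsAdjointPair B B f f') (k : ℕ) :
    LinearMap.IsAdjointPair B B (f ^ k : Module.End R M) (f' ^ k : Module.End R M) := by
  induction k with
  | zero => exact fun _ _ => rfl
  | succ k ih =>
    rw [pow_succ, pow_succ']
    exact ih.mul h

/-- Composition of iterated partial derivatives along a list of coordinates. -/
noncomputable def schwartzListPDeriv {m : ℕ} (α : Fin m → ℕ) (l : List (Fin m)) :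
    Module.End ℝ 𝓢(Fin m → ℝ, ℝ) :=
  (l.map fun i => schwartzPDeriv i ^ α i).prod

theorem coe_schwartzListPDeriv {m : ℕ} (α : Fin m → ℕ) (l : List (Fin m))
    (φ : 𝓢(Fin m → ℝ, ℝ)) :
    ⇑(schwartzListPDeriv α l φ) = l.foldr (fun i g => (pderivOp i)^[α i] g) φ := by
  have hpow (i : Fin m) (k : ℕ) (ψ : 𝓢(Fin m → ℝ, ℝ)) :
      ⇑((schwartzPDeriv i ^ k) ψ) = (pderivOp i)^[k] ψ := by
    induction k with
    | zero => rfl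
    | succ k ih =>
      rw [pow_succ', Module.End.mul_apply, coe_schwartzPDeriv, ih, Function.iterate_succ_apply']
  induction l with
  | nil => rfl
  | cons i l ih =>
    rw [List.foldr_cons, ← ih, ← hpow]
    rfl

theorem isAdjointPair_schwartzListPDeriv {m : ℕ} (α : Fin m → ℕ) (l : List (Fin m)) :
    LinearMap.IsAdjointPair (l2Form m) (l2Form m) (schwartzListPDeriv α l)
      ((-1 : ℝ) ^ (l.map α).sum • schwartzListPDeriv α l :
        Module.End ℝ 𝓢(Fin m → ℝ, ℝ)) := by
  induction l with
  | nil => intro φ ψ; simp [schwartzListPDeriv]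
  | cons i l ih =>
    have hcomm : Commute (schwartzListPDeriv α l) (schwartzPDeriv i ^ α i) := by
      refine Commute.list_prod_left _ _ fun T hT => ?_
      obtain ⟨j, -, rfl⟩ := List.mem_map.1 hT
      exact (commute_schwartzPDeriv j i).pow_pow _ _
    have h := ((isAdjointPair_schwartzPDeriv i).pow (α i)).mul ih
    have hneg : (-schwartzPDeriv i) ^ α i = (-1 : ℝ) ^ α i • schwartzPDeriv i ^ α i := by
      rw [← neg_one_smul ℝ (schwartzPDeriv i), smul_pow]
    rw [hneg, smul_mul_smul_comm, hcomm.eq, ← pow_add, add_comm] at h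
    simpa [schwartzListPDeriv] using h

theorem hasTemperateGrowth_eval {m : ℕ} (c : MvPolynomial (Fin m) ℝ) :
    Function.HasTemperateGrowth fun x : Fin m → ℝ => MvPolynomial.eval x c := by
  induction c using MvPolynomial.induction_on with
  | C a => simp
  | add p q hp hq => simpa using! hp.add hq
  | mul_X p i hp =>
    simpa using! hp.mul (ContinuousLinearMap.proj (R := ℝ) (φ := fun _ : Fin m => ℝ)
      i).hasTemperateGrowth

/-- Multiplication by a polynomial on Schwartz space. -/
noncomputable def schwartzPolyMul {m : ℕ} (c : MvPolynomial (Fin m) ℝ) :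
    Module.End ℝ 𝓢(Fin m → ℝ, ℝ) :=
  (SchwartzMap.smulLeftCLM ℝ fun x : Fin m → ℝ => MvPolynomial.eval x c).toLinearMap

theorem schwartzPolyMul_apply {m : ℕ} (c : MvPolynomial (Fin m) ℝ) (φ : 𝓢(Fin m → ℝ, ℝ))
    (x : Fin m → ℝ) : schwartzPolyMul c φ x = MvPolynomial.eval x c * φ x :=
  SchwartzMap.smulLeftCLM_apply_apply (hasTemperateGrowth_eval c) φ x

theorem isAdjointPair_schwartzPolyMul {m : ℕ} (c : MvPolynomial (Fin m) ℝ) :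
    LinearMap.IsAdjointPair (l2Form m) (l2Form m) (schwartzPolyMul c) (schwartzPolyMul c) := by
  intro φ ψ
  simp only [l2Form_apply, schwartzPolyMul_apply]
  congr with x
  ring

/-- The action of a differential operator on Schwartz space. -/
noncomputable def PDO.schwartzApp {m : ℕ} (p : PDO ℝ m) : Module.End ℝ 𝓢(Fin m → ℝ, ℝ) :=
  Finsupp.sum p fun α c => schwartzPolyMul c * schwartzListPDeriv α (List.finRange m)

/-- The formal adjoint action of a differential operator on Schwartz space. -/
noncomputable def PDO.schwartzAdj {m : ℕ} (p : PDO ℝ m) : Module.End ℝ 𝓢(Fin m → ℝ, ℝ) :=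
  Finsupp.sum p fun α c =>
    ((-1 : ℝ) ^ (∑ i, α i) • schwartzListPDeriv α (List.finRange m)) * schwartzPolyMul c

theorem PDO.coe_schwartzApp {m : ℕ} (p : PDO ℝ m) (φ : 𝓢(Fin m → ℝ, ℝ)) :
    ⇑(p.schwartzApp φ) = p.app φ := by
  ext x
  simp only [schwartzApp, app, Finsupp.sum, LinearMap.sum_apply, _root_.sum_apply]
  refine Finset.sum_congr rfl fun α _ => ?_
  rw [Module.End.mul_apply, schwartzPolyMul_apply, coe_schwartzListPDeriv]
  rfl

theorem PDO.coe_schwartzAdj {m : ℕ} (p : PDO ℝ m) (φ : 𝓢(Fin m → ℝ, ℝ)) :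
    ⇑(p.schwartzAdj φ) = p.adjApp φ := by
  ext x
  simp only [schwartzAdj, adjApp, Finsupp.sum, LinearMap.sum_apply, _root_.sum_apply]
  refine Finset.sum_congr rfl fun α _ => ?_
  rw [Module.End.mul_apply, LinearMap.smul_apply, _root_.smul_apply, smul_eq_mul,
    coe_schwartzListPDeriv, funext (schwartzPolyMul_apply _ φ)]
  rfl

theorem PDO.isAdjointPair_schwartzApp {m : ℕ} (p : PDO ℝ m) :
    LinearMap.IsAdjointPair (l2Form m) (l2Form m) p.schwartzApp p.schwartzAdj := by
  intro φ ψ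
  simp only [schwartzApp, schwartzAdj, Finsupp.sum, LinearMap.sum_apply, map_sum]
  refine Finset.sum_congr rfl fun α _ => ?_
  have h := (isAdjointPair_schwartzPolyMul (p.toFun α)).mul
    (isAdjointPair_schwartzListPDeriv α (List.finRange m))
  rw [← Fin.sum_univ_def] at h
  exact h φ ψ

/-- The 𝒮-closure of a system is a real submodule: if
`∑ᵢ pᵢ*pᵢ = ∑ⱼ (hⱼ*qⱼ + qⱼ*hⱼ)` as an identity of operators (tested on smooth
functions) and every `qⱼ` vanishes on all Schwartz solutions of the system
given by the `g`'s, then every `pᵢ` vanishes on these solutions as well. -/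
theorem schwartz_closure_is_real_submodule
    (m n r s w : ℕ) (hm : 0 < m) (hn : 0 < n) (hr : 0 < r) (hs : 0 < s)
    (hw : 0 < w)
    (g : Fin r → Fin n → PDO ℝ m) (p : Fin s → Fin n → PDO ℝ m)
    (h : Fin w → Fin n → PDO ℝ m) (q : Fin w → Fin n → PDO ℝ m)
    -- (i): every qⱼ vanishes on the Schwartz solution set S of the system g
    (hq : ∀ u : Fin n → SchwartzMap (Fin m → ℝ) ℝ,
      (∀ (l : Fin r) (x : Fin m → ℝ), ∑ b, PDO.app (g l b) (⇑(u b)) x = 0) →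
      ∀ (j : Fin w) (x : Fin m → ℝ), ∑ b, PDO.app (q j b) (⇑(u b)) x = 0)
    -- (ii): the operator identity ∑ᵢ pᵢ*pᵢ = ∑ⱼ (hⱼ*qⱼ + qⱼ*hⱼ)
    (hid : ∀ (a b : Fin n) (f : (Fin m → ℝ) → ℝ), ContDiff ℝ (⊤ : ℕ∞) f →
      ∀ x : Fin m → ℝ,
        ∑ i, PDO.adjApp (p i a) (PDO.app (p i b) f) x =
          ∑ j, (PDO.adjApp (h j a) (PDO.app (q j b) f) x +
            PDO.adjApp (q j a) (PDO.app (h j b) f) x)) :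
    ∀ u : Fin n → SchwartzMap (Fin m → ℝ) ℝ,
      (∀ (l : Fin r) (x : Fin m → ℝ), ∑ b, PDO.app (g l b) (⇑(u b)) x = 0) →
      ∀ (i : Fin s) (x : Fin m → ℝ), ∑ b, PDO.app (p i b) (⇑(u b)) x = 0 := by
  intro u hu
  have hQ (j : Fin w) : ∑ b, (q j b).schwartzApp (u b) = 0 := by
    ext x
    simpa only [_root_.sum_apply, PDO.coe_schwartzApp] using! hq u hu j x
  have hid' (a b : Fin n) (φ : 𝓢(Fin m → ℝ, ℝ)) :
      ∑ i, (p i a).schwartzAdj ((p i b).schwartzApp φ) =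
        ∑ j, ((h j a).schwartzAdj ((q j b).schwartzApp φ) +
          (q j a).schwartzAdj ((h j b).schwartzApp φ)) := by
    ext x
    simpa only [_root_.sum_apply, _root_.add_apply, PDO.coe_schwartzAdj,
      PDO.coe_schwartzApp] using hid a b φ (φ.smooth _) x
  have expand (P P' : Fin n → PDO ℝ m) :
      l2Form m (∑ a, (P a).schwartzApp (u a)) (∑ b, (P' b).schwartzApp (u b)) =
        ∑ a, ∑ b, l2Form m (u a) ((P a).schwartzAdj ((P' b).schwartzApp (u b))) := by
    simp only [map_sum, LinearMap.sum_apply]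
    rw [Finset.sum_comm]
    exact Finset.sum_congr rfl fun a _ => Finset.sum_congr rfl fun b _ =>
      (P a).isAdjointPair_schwartzApp _ _
  have hsum : ∑ i, l2Form m (∑ b, (p i b).schwartzApp (u b))
      (∑ b, (p i b).schwartzApp (u b)) = 0 := calc
    _ = ∑ a, ∑ b, l2Form m (u a)
        (∑ i, (p i a).schwartzAdj ((p i b).schwartzApp (u b))) := by
      simp_rw [expand, map_sum]
      rw [Finset.sum_comm]
      exact Finset.sum_congr rfl fun a _ => Finset.sum_comm
    _ = ∑ j, (l2Form m (∑ b, (h j b).schwartzApp (u b)) (∑ b, (q j b).schwartzApp (u b)) +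
        l2Form m (∑ b, (q j b).schwartzApp (u b)) (∑ b, (h j b).schwartzApp (u b))) := by
      simp_rw [expand, hid', map_sum, map_add, ← Finset.sum_add_distrib]
      rw [Finset.sum_comm (s := (Finset.univ : Finset (Fin w)))]
      exact Finset.sum_congr rfl fun a _ => Finset.sum_comm
    _ = 0 := by simp [hQ]
  intro i x
  have hi := eq_zero_of_l2Form_self
    ((Finset.sum_eq_zero_iff_of_nonneg fun i _ => l2Form_self_nonneg _).1 hsum i
      (Finset.mem_univ i))
  simpa only [_root_.sum_apply, PDO.coe_schwartzApp] using! DFunLike.congr_fun hi x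
end
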